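/- The AG-generating map is well-defined with respect to splitting the marginalisation and conditioning sets: for an ancestral graph H = (N,F) and pairwise disjoint subsets C, C₁, M, M₁ of N, α_AG(α_AG(H;M,C);M₁,C₁) = α_AG(H;M∪M₁,C∪C₁). -/

import Mathlib

/-!
Stable mixed graphs: mixed graphs with arrows, arcs and lines; ribbonless,
summary and ancestral graphs; the generating maps α_RG, α_SG, α_AG;
m-connecting paths, m-separation and induced independence models.
-/

namespace StableMixedGraphs

/-- A mixed graph on node type `V`: a node set together with three edge
relations: arrows (`arrow i j` means an arrow from `i` to `j`), arcs
(two-headed, symmetric) and lines (undirected, symmetric). -/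
structure MixedGraph (V : Type) where
  nodes : Set V
  arrow : V → V → Prop
  arc : V → V → Prop
  line : V → V → Prop

namespace MixedGraph

variable {V W : Type}

/-- Wellformedness: arcs and lines are symmetric relations and all edges join
nodes of the graph. -/
def Wf (G : MixedGraph V) : Prop :=
  (∀ i j, G.arc i j → G.arc j i) ∧
  (∀ i j, G.line i j → G.line j i) ∧
  (∀ i j, G.arrow i j ∨ G.arc i j ∨ G.line i j → i ∈ G.nodes ∧ j ∈ G.nodes)

/-- No loops of any of the three kinds. -/
def Loopless (G : MixedGraph V) : Prop :=
  ∀ i, ¬ G.arrow i i ∧ ¬ G.arc i i ∧ ¬ G.line i i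

/-- A loopless mixed graph with a finite node set. -/
def IsLMG (G : MixedGraph V) : Prop := G.Wf ∧ G.Loopless ∧ G.nodes.Finite

/-- `G.anc i j` : `i` is an ancestor of `j`, i.e. there is a
direction-preserving path from `i` to `j`. -/
def anc (G : MixedGraph V) (i j : V) : Prop := Relation.TransGen G.arrow i j

/-- The set of ancestors of nodes of `C`. -/
def anSet (G : MixedGraph V) (C : Set V) : Set V := {a | ∃ c ∈ C, G.anc a c}

/-- `i` lies on a direction-preserving cycle. -/
def OnDPCycle (G : MixedGraph V) (i : V) : Prop := G.anc i i

/-- `i` is an endpoint of a line. -/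
def LineEndpoint (G : MixedGraph V) (i : V) : Prop := ∃ j, G.line i j

/-- Condition (2) of a ribbon: `i` or a descendant of `i` is an endpoint of a
line or lies on a direction-preserving cycle. -/
def RibbonTail (G : MixedGraph V) (i : V) : Prop :=
  ∃ d, (d = i ∨ G.anc i d) ∧ (G.LineEndpoint d ∨ G.OnDPCycle d)

/-- `G` contains a ribbon: a collider V-configuration `⟨h,i,j⟩` with no
endpoint-identical edge between `h` and `j`, whose inner node `i` (or a
descendant of it) is an endpoint of a line or on a direction-preserving
cycle. -/
def HasRibbon (G : MixedGraph V) : Prop :=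
  ∃ h i j, h ≠ i ∧ i ≠ j ∧ h ≠ j ∧ G.RibbonTail i ∧
    ((G.arc h i ∧ G.arc i j ∧ ¬ G.arc h j) ∨
     (G.arrow h i ∧ G.arrow j i ∧ ¬ G.line h j) ∨
     (G.arrow h i ∧ G.arc i j ∧ ¬ G.arrow h j))

/-- A ribbonless graph: a loopless mixed graph with no ribbon. -/
def IsRG (G : MixedGraph V) : Prop := G.IsLMG ∧ ¬ G.HasRibbon

/-- A directed acyclic graph: only arrows, no direction-preserving cycle. -/
def IsDAG (G : MixedGraph V) : Prop :=
  G.IsLMG ∧ (∀ i j, ¬ G.arc i j) ∧ (∀ i j, ¬ G.line i j) ∧ ∀ i, ¬ G.anc i i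

/-- A summary graph: a loopless mixed graph with no arrowhead pointing to an
endpoint of a line and no direction-preserving cycle. -/
def IsSG (G : MixedGraph V) : Prop :=
  G.IsLMG ∧ (∀ i, G.LineEndpoint i → ∀ k, ¬ G.arrow k i ∧ ¬ G.arc k i) ∧
    ∀ i, ¬ G.anc i i

/-- A simple mixed graph: no loops and no multiple edges. -/
def Simple (G : MixedGraph V) : Prop :=
  G.Loopless ∧ ∀ i j,
    (G.arrow i j → ¬ G.arrow j i ∧ ¬ G.arc i j ∧ ¬ G.line i j) ∧
    (G.arc i j → ¬ G.line i j)

/-- An ancestral graph: a simple mixed graph such that no node is an ancestor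
of one of its parents or spouses, and a node with a neighbour has neither
parents nor spouses. -/
def IsAG (G : MixedGraph V) : Prop :=
  G.Wf ∧ G.Simple ∧ G.nodes.Finite ∧
  (∀ i j, G.arrow j i ∨ G.arc j i → ¬ G.anc i j) ∧
  (∀ i, G.LineEndpoint i → ∀ k, ¬ G.arrow k i ∧ ¬ G.arc k i)

/-- An undirected graph: only lines. -/
def IsUG (G : MixedGraph V) : Prop :=
  G.IsLMG ∧ (∀ i j, ¬ G.arrow i j) ∧ ∀ i j, ¬ G.arc i j

/-- A bidirected graph: only arcs. -/
def IsBG (G : MixedGraph V) : Prop :=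
  G.IsLMG ∧ (∀ i j, ¬ G.arrow i j) ∧ ∀ i j, ¬ G.line i j

/-- Image of a mixed graph under a map of node types. -/
def map (f : V → W) (G : MixedGraph V) : MixedGraph W where
  nodes := f '' G.nodes
  arrow a b := ∃ i j, G.arrow i j ∧ f i = a ∧ f j = b
  arc a b := ∃ i j, G.arc i j ∧ f i = a ∧ f j = b
  line a b := ∃ i j, G.line i j ∧ f i = a ∧ f j = b

end MixedGraph

/-! ### The closure generating new edges (Table 1 of the RG-generating
algorithm), for given marginalisation set `M` and collider set
`S = C ∪ an(C)`.  For every V-configuration whose inner node is a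
non-collider in `M` (rows 1–7) or a collider in `S` (rows 8–10) the
endpoint-identical edge between the endpoints is generated, repeatedly
until closure. -/

mutual
  /-- Generated arrows (`GenArrow H M S j i`: arrow from `j` to `i`). -/
  inductive GenArrow {V : Type} (H : MixedGraph V) (M S : Set V) : V → V → Prop
    | base {i j : V} : H.arrow i j → GenArrow H M S i j
    | row1 {i j m : V} : m ∈ M → j ≠ i →
        GenArrow H M S j m → GenArrow H M S m i → GenArrow H M S j i
    | row2 {i j m : V} : m ∈ M → j ≠ i →
        GenLine H M S j m → GenArrow H M S m i → GenArrow H M S j i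
    | row3 {i j m : V} : m ∈ M → j ≠ i →
        GenLine H M S j m → GenArc H M S m i → GenArrow H M S j i
    | row8 {i j s : V} : s ∈ S → j ≠ i →
        GenArrow H M S j s → GenArc H M S s i → GenArrow H M S j i

  /-- Generated arcs. -/
  inductive GenArc {V : Type} (H : MixedGraph V) (M S : Set V) : V → V → Prop
    | base {i j : V} : H.arc i j → GenArc H M S i j
    | symm {i j : V} : GenArc H M S i j → GenArc H M S j i
    | row4 {i j m : V} : m ∈ M → i ≠ j →
        GenArrow H M S m i → GenArrow H M S m j → GenArc H M S i j
    | row5 {i j m : V} : m ∈ M → i ≠ j →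
        GenArrow H M S m i → GenArc H M S m j → GenArc H M S i j
    | row9 {i j s : V} : s ∈ S → i ≠ j →
        GenArc H M S i s → GenArc H M S s j → GenArc H M S i j

  /-- Generated lines. -/
  inductive GenLine {V : Type} (H : MixedGraph V) (M S : Set V) : V → V → Prop
    | base {i j : V} : H.line i j → GenLine H M S i j
    | symm {i j : V} : GenLine H M S i j → GenLine H M S j i
    | row6 {i j m : V} : m ∈ M → i ≠ j →
        GenLine H M S i m → GenArrow H M S j m → GenLine H M S i j
    | row7 {i j m : V} : m ∈ M → i ≠ j →
        GenLine H M S i m → GenLine H M S m j → GenLine H M S i j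
    | row10 {i j s : V} : s ∈ S → i ≠ j →
        GenArrow H M S i s → GenArrow H M S j s → GenLine H M S i j
end

variable {V : Type}

/-- The RG-generating map `α_RG(H;M,C)`: generate all edges of the closure
and delete the nodes of `M ∪ C`. -/
def alphaRG (H : MixedGraph V) (M C : Set V) : MixedGraph V where
  nodes := H.nodes \ (M ∪ C)
  arrow i j := i ∈ H.nodes \ (M ∪ C) ∧ j ∈ H.nodes \ (M ∪ C) ∧
    GenArrow H M (C ∪ H.anSet C) i j
  arc i j := i ∈ H.nodes \ (M ∪ C) ∧ j ∈ H.nodes \ (M ∪ C) ∧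
    GenArc H M (C ∪ H.anSet C) i j
  line i j := i ∈ H.nodes \ (M ∪ C) ∧ j ∈ H.nodes \ (M ∪ C) ∧
    GenLine H M (C ∪ H.anSet C) i j

/-- The arrowhead-removal operation `α_RG.SG(K;A)`: every arrowhead pointing
at a node of `A` is removed (an arrow at such a node becomes a line, an arc
becomes an arrow, an arc with both endpoints in `A` becomes a line),
repeatedly until closure. -/
def deheadAt (K : MixedGraph V) (A : Set V) : MixedGraph V where
  nodes := K.nodes
  arrow j i := i ∉ A ∧ (K.arrow j i ∨ (K.arc j i ∧ j ∈ A))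
  arc i j := K.arc i j ∧ i ∉ A ∧ j ∉ A
  line i j := K.line i j ∨ (K.arrow j i ∧ i ∈ A) ∨ (K.arrow i j ∧ j ∈ A) ∨
    (K.arc i j ∧ i ∈ A ∧ j ∈ A)

/-- The SG-generating map `α_SG(H;M,C)`: mark the nodes of `an(C)`, apply the
RG-generating construction, then remove all arrowheads pointing at marked
nodes. -/
def alphaSG (H : MixedGraph V) (M C : Set V) : MixedGraph V :=
  deheadAt (alphaRG H M C) (H.anSet C)

/-! ### Step 2 of the AG-generating algorithm: for every V-configuration
`j → k ↔ i` or `j ↔ k ↔ i` with `k ∈ an(i)` (in the current graph) generate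
an arrow from `j` to `i`, respectively an arc between `j` and `i`, until
closure. -/

mutual
  inductive AG2Arrow {V : Type} (K : MixedGraph V) : V → V → Prop
    | base {i j : V} : K.arrow j i → AG2Arrow K j i
    | gen {i j k : V} : j ≠ i → AG2Arrow K j k → AG2Arc K k i →
        AG2Anc K k i → AG2Arrow K j i

  inductive AG2Arc {V : Type} (K : MixedGraph V) : V → V → Prop
    | base {i j : V} : K.arc i j → AG2Arc K i j
    | symm {i j : V} : AG2Arc K i j → AG2Arc K j i
    | gen {i j k : V} : j ≠ i → AG2Arc K j k → AG2Arc K k i →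
        AG2Anc K k i → AG2Arc K j i

  /-- The ancestor relation of the graph being generated in step 2. -/
  inductive AG2Anc {V : Type} (K : MixedGraph V) : V → V → Prop
    | single {i j : V} : AG2Arrow K i j → AG2Anc K i j
    | tail {i k j : V} : AG2Arrow K i k → AG2Anc K k j → AG2Anc K i j
end

/-- The graph after step 2 of the AG-generating algorithm. -/
def ag2 (K : MixedGraph V) : MixedGraph V where
  nodes := K.nodes
  arrow := AG2Arrow K
  arc := AG2Arc K
  line := K.line

/-! ### Step 3 of the AG-generating algorithm: repeatedly replace every arc
between `j` and `i` with `j ∈ an(i)` (in the current graph) by an arrow from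
`j` to `i`. -/

mutual
  inductive AG3Arrow {V : Type} (K : MixedGraph V) : V → V → Prop
    | base {i j : V} : K.arrow j i → AG3Arrow K j i
    | conv {i j : V} : K.arc j i → AG3Anc K j i → AG3Arrow K j i

  /-- The ancestor relation of the graph being generated in step 3. -/
  inductive AG3Anc {V : Type} (K : MixedGraph V) : V → V → Prop
    | single {i j : V} : AG3Arrow K i j → AG3Anc K i j
    | tail {i k j : V} : AG3Arrow K i k → AG3Anc K k j → AG3Anc K i j
end

/-- Steps 2 and 3 of the AG-generating algorithm, applied to a summary
graph: `α_SG.AG`. -/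
def alphaSGAG (K : MixedGraph V) : MixedGraph V :=
  let K2 := ag2 K
  { nodes := K.nodes
    arrow := AG3Arrow K2
    arc := fun i j => K2.arc i j ∧ ¬ AG3Anc K2 i j ∧ ¬ AG3Anc K2 j i
    line := K.line }

/-- The AG-generating map `α_AG(H;M,C)`. -/
def alphaAG (H : MixedGraph V) (M C : Set V) : MixedGraph V :=
  alphaSGAG (alphaSG H M C)

/-! ### Paths, m-connection and m-separation. -/

/-- A step of a walk: it goes from `src` to `tgt` along an edge which has an
arrowhead at `src` iff `hs = true` and an arrowhead at `tgt` iff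
`ht = true` (so `hs = ht = false` is a line, `hs = ht = true` an arc, and
exactly one head an arrow in the corresponding direction). -/
structure Step (V : Type) where
  src : V
  tgt : V
  hs : Bool
  ht : Bool

/-- The edge of a step is present in `G`. -/
def Step.valid (G : MixedGraph V) (s : Step V) : Prop :=
  match s.hs, s.ht with
  | false, false => G.line s.src s.tgt
  | false, true  => G.arrow s.src s.tgt
  | true,  false => G.arrow s.tgt s.src
  | true,  true  => G.arc s.src s.tgt

/-- `w` is a path from `i` to `j` in `G`: a nonempty chained list of valid
steps with no repeated nodes. -/
def IsPath (G : MixedGraph V) (i j : V) (w : List (Step V)) : Prop :=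
  w ≠ [] ∧ (∀ s ∈ w, s.valid G) ∧ List.Chain' (fun a b => a.tgt = b.src) w ∧
    w.head?.map Step.src = some i ∧ w.getLast?.map Step.tgt = some j ∧
    (i :: w.map Step.tgt).Nodup

/-- The path `w` is m-connecting given `M` and `C`: every inner collider node
is in `C ∪ an(C)` and every inner non-collider node is in `M`. -/
def MConnPath (G : MixedGraph V) (M C : Set V) (w : List (Step V)) : Prop :=
  List.Chain'
    (fun a b =>
      (a.ht = true ∧ b.hs = true → a.tgt ∈ C ∪ G.anSet C) ∧
      (¬ (a.ht = true ∧ b.hs = true) → a.tgt ∈ M)) w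

/-- `A ⊥_m B | C` in `G` : there is no m-connecting path between `A` and `B`
given `C` (with `M` the remaining nodes). -/
def MSep (G : MixedGraph V) (A B C : Set V) : Prop :=
  ∀ i ∈ A, ∀ j ∈ B, ∀ w : List (Step V),
    IsPath G i j w → ¬ MConnPath G (G.nodes \ (A ∪ B ∪ C)) C w

/-- The independence model induced by `G` via m-separation: the set of
triples `⟨A,B|C⟩` of pairwise disjoint subsets of the nodes with
`A ⊥_m B | C`. -/
def Jm (G : MixedGraph V) : Set (Set V × Set V × Set V) :=
  {t | t.1 ⊆ G.nodes ∧ t.2.1 ⊆ G.nodes ∧ t.2.2 ⊆ G.nodes ∧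
    Disjoint t.1 t.2.1 ∧ Disjoint t.1 t.2.2 ∧ Disjoint t.2.1 t.2.2 ∧
    MSep G t.1 t.2.1 t.2.2}

/-- The independence model after marginalisation over `M` and conditioning on
`C` : `α(J;M,C)`. -/
def alphaIM (J : Set (Set V × Set V × Set V)) (M C : Set V) :
    Set (Set V × Set V × Set V) :=
  {t | (t.1, t.2.1, t.2.2 ∪ C) ∈ J ∧ (t.1 ∪ t.2.1 ∪ t.2.2) ∩ (M ∪ C) = ∅}

/-! ### Closures of labelled edge relations -/

/-- The closure of a labelled edge relation `E` under concatenating two edges that meet at a node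
where `pass` holds; `pass b c m i j` concerns the labels `b`, `c` at the inner node `m` of a
configuration with endpoints `i` and `j`. -/
inductive Cl {L : Type} (E : L → L → V → V → Prop) (pass : L → L → V → V → V → Prop) :
    L → L → V → V → Prop
  | base {a b : L} {i j : V} : E a b i j → Cl E pass a b i j
  | comp {a b c d : L} {i m j : V} : Cl E pass a b i m → Cl E pass c d m j →
      pass b c m i j → Cl E pass a d i j

/-- `Cl` with the number of edges used. -/
inductive SCl {L : Type} (E : L → L → V → V → Prop) (pass : L → L → V → V → V → Prop) :
    ℕ → L → L → V → V → Prop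
  | base {a b : L} {i j : V} : E a b i j → SCl E pass 1 a b i j
  | comp {n k : ℕ} {a b c d : L} {i m j : V} : SCl E pass n a b i m → SCl E pass k c d m j →
      pass b c m i j → SCl E pass (n + k) a d i j

section Closure

variable {L : Type} {E E' : L → L → V → V → Prop} {pass pass' : L → L → V → V → V → Prop}

theorem Cl.mono (hE : ∀ a b i j, E a b i j → E' a b i j)
    (hp : ∀ b c m i j, pass b c m i j → pass' b c m i j) {a b : L} {i j : V}
    (h : Cl E pass a b i j) : Cl E' pass' a b i j := by
  induction h with
  | base h => exact .base (hE _ _ _ _ h)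
  | comp _ _ hp' ih₁ ih₂ => exact .comp ih₁ ih₂ (hp _ _ _ _ _ hp')

theorem Cl.symm (hE : ∀ a b i j, E a b i j → E b a j i)
    (hp : ∀ b c m i j, pass b c m i j → pass c b m j i) {a b : L} {i j : V}
    (h : Cl E pass a b i j) : Cl E pass b a j i := by
  induction h with
  | base h => exact .base (hE _ _ _ _ h)
  | comp _ _ hp' ih₁ ih₂ => exact .comp ih₂ ih₁ (hp _ _ _ _ _ hp')

theorem SCl.toCl {n : ℕ} {a b : L} {i j : V} (h : SCl E pass n a b i j) : Cl E pass a b i j := by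
  induction h with
  | base h => exact .base h
  | comp _ _ hp' ih₁ ih₂ => exact .comp ih₁ ih₂ hp'

theorem SCl.pos {n : ℕ} {a b : L} {i j : V} (h : SCl E pass n a b i j) : 0 < n := by
  induction h with
  | base h => exact Nat.one_pos
  | comp _ _ hp' ih₁ ih₂ => omega

theorem SCl.symm (hE : ∀ a b i j, E a b i j → E b a j i)
    (hp : ∀ b c m i j, pass b c m i j → pass c b m j i) {n : ℕ} {a b : L} {i j : V}
    (h : SCl E pass n a b i j) : SCl E pass n b a j i := by
  induction h with
  | base h => exact .base (hE _ _ _ _ h)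
  | comp _ _ hp' ih₁ ih₂ => rw [Nat.add_comm]; exact .comp ih₂ ih₁ (hp _ _ _ _ _ hp')

end Closure

/-- An inner node passes in the RG-generating algorithm. -/
def RgPass (M S : Set V) (b c : Bool) (m : V) : Prop :=
  (b = true ∧ c = true ∧ m ∈ S) ∨ ((b = false ∨ c = false) ∧ m ∈ M)

/-- An inner node passes in the RG-generating algorithm or, for the ancestor relation `P`, in
step 2 of the AG-generating algorithm. -/
def AgPass (P : V → V → Prop) (M S : Set V) (b c : Bool) (m i j : V) : Prop :=
  (b = true ∧ c = true ∧ (m ∈ S ∨ P m i ∨ P m j)) ∨ ((b = false ∨ c = false) ∧ m ∈ M)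

theorem RgPass.symm {M S : Set V} {b c : Bool} {m : V} (h : RgPass M S b c m) :
    RgPass M S c b m := by
  unfold RgPass at *; tauto

theorem AgPass.symm {P : V → V → Prop} {M S : Set V} {b c : Bool} {m i j : V}
    (h : AgPass P M S b c m i j) : AgPass P M S c b m j i := by
  unfold AgPass at *; tauto

theorem RgPass.agPass {P : V → V → Prop} {M S : Set V} {b c : Bool} {m i j : V}
    (h : RgPass M S b c m) : AgPass P M S b c m i j := by
  unfold AgPass RgPass at *; tauto

/-- A strict order `P` (ancestry) together with a `P`-closed set `Z` of nodes. -/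
structure Anterior (P : V → V → Prop) (Z : Set V) : Prop where
  trans : ∀ i j k, P i j → P j k → P i k
  irrefl : ∀ i, ¬ P i i
  closed : ∀ i j, P i j → j ∈ Z → i ∈ Z

/-- The heads of `E` are compatible with `P` and `Z`: there is no head at a node of `Z`, and a
tail at a node outside `Z` makes it an ancestor of the other endpoint. -/
structure Compat (E : Bool → Bool → V → V → Prop) (P : V → V → Prop) (Z : Set V) : Prop where
  symm : ∀ a b i j, E a b i j → E b a j i
  tail : ∀ b i j, E false b i j → i ∈ Z ∨ P i j
  head : ∀ b i j, E true b i j → i ∉ Z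

section Compat

variable {E : Bool → Bool → V → V → Prop} {P : V → V → Prop} {Z M S : Set V}
  {pass : Bool → Bool → V → V → V → Prop}

theorem Cl.headOf (hE : Compat E P Z) {a b : Bool} {i j : V} (h : Cl E pass a b i j) :
    (a = true → i ∉ Z) ∧ (b = true → j ∉ Z) := by
  induction h with
  | base h =>
    refine ⟨?_, ?_⟩ <;> rintro rfl
    · exact hE.head _ _ _ h
    · exact hE.head _ _ _ (hE.symm _ _ _ _ h)
  | comp _ _ _ ih₁ ih₂ => exact ⟨ih₁.1, ih₂.2⟩

theorem Cl.tailOf (hP : Anterior P Z) (hE : Compat E P Z) (hS : ∀ i j, P i j → j ∈ S → i ∈ S)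
    (hp : ∀ b c m i j, pass b c m i j → AgPass P M S b c m i j)
    {a b : Bool} {i j : V} (h : Cl E pass a b i j) :
    (a = false → i ∈ Z ∨ i ∈ S ∨ P i j) ∧ (b = false → j ∈ Z ∨ j ∈ S ∨ P j i) := by
  induction h with
  | base h =>
    refine ⟨?_, ?_⟩ <;> rintro rfl
    · have := hE.tail _ _ _ h; tauto
    · have := hE.tail _ _ _ (hE.symm _ _ _ _ h); tauto
  | @comp a b c d i m j _ _ h ih₁ ih₂ =>
    have h := hp _ _ _ _ _ h
    have t := hP.trans
    have r := hP.irrefl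
    have z := hP.closed
    unfold AgPass at h
    grind

end Compat

/-! ### Removing loops -/

/-- The label `a` at the node `i` can be replaced by `c` as far as passing at `i` is concerned. -/
def Dom (M S : Set V) (a c : Bool) (i : V) : Prop :=
  a = c ∨ (c = true ∧ i ∈ S) ∨ (c = false ∧ i ∈ M)

theorem Dom.trans {M S : Set V} {a b c : Bool} {i : V} (h : Dom M S a b i) (h' : Dom M S b c i) :
    Dom M S a c i := by
  unfold Dom at *; grind

theorem Cl.loopless {E E' : Bool → Bool → V → V → Prop} {Z M S : Set V}
    {pass : Bool → Bool → V → V → V → Prop}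
    (hsym : ∀ b c m i j, pass b c m i j → pass c b m j i)
    (hM : ∀ b c m i j, pass b c m i j → c = false → m ∈ M)
    (hhead : ∀ a b i j, Cl E pass a b i j → a = true → i ∉ Z)
    (hloop : ∀ a b i, Cl E pass a b i i → a = false → i ∈ Z ∨ i ∈ S)
    (hE : ∀ a b i j, E a b i j → E b a j i)
    (hbase : ∀ a b i j, E a b i j → i ≠ j →
      ∃ a' b', E' a' b' i j ∧ Dom M S a a' i ∧ Dom M S b b' j)
    (hpass : ∀ b b' c c' m i j, pass b c m i j → Dom M S b b' m → Dom M S c c' m →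
      pass b' c' m i j)
    {a b : Bool} {i j : V} (h : Cl E pass a b i j) (hij : i ≠ j) :
    ∃ a' b', Cl E' (fun b c m i j => i ≠ j ∧ pass b c m i j) a' b' i j ∧
      Dom M S a a' i ∧ Dom M S b b' j := by
  have key : ∀ a b c d i j, Cl E pass a b i i → Cl E pass c d i j → (c = false → i ∈ M) →
      Dom M S a c i := by
    intro a b c d i j h₁ h₂ h₃
    have h₄ := hloop _ _ _ h₁
    have h₅ := hhead _ _ _ _ h₂
    unfold Dom
    cases a <;> cases c <;> simp_all
  induction h with
  | base h =>
    obtain ⟨a', b', h, h'⟩ := hbase _ _ _ _ h hij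
    exact ⟨a', b', .base h, h'⟩
  | @comp a b c d i m j h₁ h₂ h ih₁ ih₂ =>
    by_cases him : i = m
    · subst him
      obtain ⟨c', d', h', hc, hd⟩ := ih₂ hij
      exact ⟨c', d', h', (key _ _ _ _ _ _ h₁ h₂ (hM _ _ _ _ _ h)).trans hc, hd⟩
    by_cases hmj : m = j
    · subst hmj
      obtain ⟨a', b', h', ha, hb⟩ := ih₁ hij
      exact ⟨a', b', h', ha, (key _ _ _ _ _ _ (h₂.symm hE hsym) (h₁.symm hE hsym)
        (hM _ _ _ _ _ (hsym _ _ _ _ _ h))).trans hb⟩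
    obtain ⟨a', b', h₁', ha, hb⟩ := ih₁ him
    obtain ⟨c', d', h₂', hc, hd⟩ := ih₂ hmj
    exact ⟨a', d', .comp h₁' h₂' ⟨hij, hpass _ _ _ _ _ _ _ h hb hc⟩, ha, hd⟩

/-! ### Absorbing inner nodes into leaves

Edges carry pairs of labels: the label of a generated edge, and the label that is left after the
arrowheads pointing to ancestors have been removed. -/

/-- Two leaves meeting at `m` can be merged into one leaf. -/
def Mergeable (M S : Set V) (b c : Bool × Bool) (m : V) : Prop :=
  RgPass M S b.1 c.1 m ∨ (b.1 = true ∧ c.1 = true ∧ (b.2 = false ∨ c.2 = false))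

/-- An inner node in `N` passes, and the adjacent leaves cannot be merged. -/
def StuckPass (P : V → V → Prop) (N M S M₁ T : Set V) (b c : Bool × Bool) (m i j : V) : Prop :=
  m ∈ N ∧ AgPass P M₁ T b.1 c.1 m i j ∧ ¬ Mergeable M S b c m

/-- The properties of leaves that make absorption possible. -/
structure Leaves (F : Bool × Bool → Bool × Bool → V → V → Prop) (P : V → V → Prop)
    (Z M S T : Set V) : Prop where
  symm : ∀ a b i j, F a b i j → F b a j i
  le : ∀ a b i j, F a b i j → a.2 = true → a.1 = true
  head : ∀ a b i j, F a b i j → a.1 = true → i ∉ Z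
  tail : ∀ a b i j, F a b i j → a.2 = false → i ∈ Z ∨ i ∈ T ∨ P i j
  merge : ∀ a b c d i m j, F a b i m → F c d m j → Mergeable M S b c m →
    ∃ a' d', a'.1 = a.1 ∧ d'.1 = d.1 ∧ F a' d' i j

section Absorb

variable {F : Bool × Bool → Bool × Bool → V → V → Prop} {P : V → V → Prop}
  {Z N M S M₁ T : Set V}

theorem Mergeable.symm {b c : Bool × Bool} {m : V} (h : Mergeable M S b c m) :
    Mergeable M S c b m := by
  unfold Mergeable RgPass at *; tauto

theorem StuckPass.symm {b c : Bool × Bool} {m i j : V} (h : StuckPass P N M S M₁ T b c m i j) :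
    StuckPass P N M S M₁ T c b m j i :=
  ⟨h.1, h.2.1.symm, fun h' => h.2.2 h'.symm⟩

theorem Leaves.closure (hF : Leaves F P Z M S T) (hP : Anterior P Z)
    (hT : ∀ i j, P i j → j ∈ T → i ∈ T) {a b : Bool × Bool} {i j : V}
    (h : Cl F (StuckPass P N M S M₁ T) a b i j) :
    ((a.2 = true → a.1 = true) ∧ (a.1 = true → i ∉ Z) ∧
      (a.2 = false → i ∈ Z ∨ i ∈ T ∨ P i j)) ∧
    ((b.2 = true → b.1 = true) ∧ (b.1 = true → j ∉ Z) ∧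
      (b.2 = false → j ∈ Z ∨ j ∈ T ∨ P j i)) := by
  induction h with
  | base h =>
    have h' := hF.symm _ _ _ _ h
    exact ⟨⟨hF.le _ _ _ _ h, hF.head _ _ _ _ h, hF.tail _ _ _ _ h⟩,
      ⟨hF.le _ _ _ _ h', hF.head _ _ _ _ h', hF.tail _ _ _ _ h'⟩⟩
  | @comp a b c d i m j _ _ h ih₁ ih₂ =>
    refine ⟨⟨ih₁.1.1, ih₁.1.2.1, ?_⟩, ⟨ih₂.2.1, ih₂.2.2.1, ?_⟩⟩
    all_goals
      obtain ⟨-, h, h'⟩ := h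
      have t := hP.trans
      have r := hP.irrefl
      have z := hP.closed
      unfold AgPass at h
      unfold Mergeable at h'
      grind

/-- If `k` passes as an ancestor of `p`, and `p` is absorbed, then `k` still passes. -/
theorem Leaves.transfer (hF : Leaves F P Z M S T) (hP : Anterior P Z)
    (hT : ∀ i j, P i j → j ∈ T → i ∈ T) (hST : S ⊆ T)
    {b c d f : Bool × Bool} {k p j : V}
    (h₁ : Cl F (StuckPass P N M S M₁ T) f b k p) (h₂ : Cl F (StuckPass P N M S M₁ T) c d p j)
    (hm : Mergeable M S b c p) (hf : f.1 = true) (hk : P k p) : k ∈ T ∨ P k j := by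
  have h₁ := hF.closure hP hT h₁
  have h₂ := hF.closure hP hT h₂
  have t := hP.trans
  have r := hP.irrefl
  have z := hP.closed
  have hs := @hST p
  unfold Mergeable RgPass at hm
  grind

theorem Leaves.absorb_aux (hF : Leaves F P Z M S T) (hP : Anterior P Z)
    (hT : ∀ i j, P i j → j ∈ T → i ∈ T) (hST : S ⊆ T) (n : ℕ) :
    ∀ (n₁ n₂ : ℕ) (a b c d : Bool × Bool) (i p j : V), n₁ + n₂ ≤ n →
      SCl F (StuckPass P N M S M₁ T) n₁ a b i p → SCl F (StuckPass P N M S M₁ T) n₂ c d p j →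
      ((p ∈ N ∧ AgPass P M₁ T b.1 c.1 p i j) → ∃ n' a' d', n' ≤ n₁ + n₂ ∧ a'.1 = a.1 ∧
        d'.1 = d.1 ∧ SCl F (StuckPass P N M S M₁ T) n' a' d' i j) ∧
      (Mergeable M S b c p → ∃ n' a' d', n' < n₁ + n₂ ∧ a'.1 = a.1 ∧
        d'.1 = d.1 ∧ SCl F (StuckPass P N M S M₁ T) n' a' d' i j) := by
  induction n using Nat.strong_induction_on with
  | _ n ih =>
  have left : ∀ (n₁ n₂ k₁ k₂ : ℕ) (a b c d e f : Bool × Bool) (i p j k : V), n₁ = k₁ + k₂ →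
      n₁ + n₂ ≤ n → SCl F (StuckPass P N M S M₁ T) k₁ a e i k →
      SCl F (StuckPass P N M S M₁ T) k₂ f b k p → StuckPass P N M S M₁ T e f k i p →
      SCl F (StuckPass P N M S M₁ T) n₂ c d p j →
      Mergeable M S b c p → ∃ n' a' d', n' < n₁ + n₂ ∧ a'.1 = a.1 ∧
        d'.1 = d.1 ∧ SCl F (StuckPass P N M S M₁ T) n' a' d' i j := by
    intro n₁ n₂ k₁ k₂ a b c d e f i p j k hn hle h₁ h₂ hs h₃ hm
    have pos := h₁.pos
    obtain ⟨n', f', d', hn', hf', hd', h⟩ :=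
      (ih (k₂ + n₂) (by omega) k₂ n₂ f b c d k p j le_rfl h₂ h₃).2 hm
    have hpass : AgPass P M₁ T e.1 f'.1 k i j := by
      have tr := hF.transfer hP hT hST h₂.toCl h₃.toCl hm
      have := hs.2.1
      rw [hf']
      unfold AgPass at this ⊢
      tauto
    obtain ⟨n'', a', d'', hn'', ha', hd'', h⟩ :=
      (ih (k₁ + n') (by omega) k₁ n' a e f' d' i k j le_rfl h₁ h).1 ⟨hs.1, hpass⟩
    exact ⟨n'', a', d'', by omega, ha', hd''.trans hd', h⟩
  intro n₁ n₂ a b c d i p j hn h₁ h₂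
  have merge : Mergeable M S b c p → ∃ n' a' d', n' < n₁ + n₂ ∧ a'.1 = a.1 ∧
        d'.1 = d.1 ∧ SCl F (StuckPass P N M S M₁ T) n' a' d' i j := by
    intro hm
    cases h₁ with
    | @comp k₁ k₂ _ e f _ _ k _ h₁ h₁' hs =>
      exact left _ _ _ _ _ _ _ _ _ _ _ _ _ _ rfl hn h₁ h₁' hs h₂ hm
    | base h₁ =>
      cases h₂ with
      | @comp k₁ k₂ _ e f _ _ k _ h₂ h₂' hs =>
        have sy := @SCl.symm _ _ F (StuckPass P N M S M₁ T) hF.symm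
          (fun _ _ _ _ _ h => h.symm)
        obtain ⟨n', d', a', hn', hd', ha', h⟩ := left (k₁ + k₂) 1 k₂ k₁ d c b a f e j p i k
          (Nat.add_comm _ _) (by omega) (sy h₂') (sy h₂) hs.symm (sy (.base h₁)) hm.symm
        exact ⟨n', a', d', by omega, ha', hd', sy h⟩
      | base h₂ =>
        obtain ⟨a', d', ha', hd', h⟩ := hF.merge _ _ _ _ _ _ _ h₁ h₂ hm
        exact ⟨1, a', d', by omega, ha', hd', .base h⟩
  refine ⟨fun h => ?_, merge⟩
  by_cases hm : Mergeable M S b c p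
  · obtain ⟨n', a', d', hn', h⟩ := merge hm
    exact ⟨n', a', d', hn'.le, h⟩
  · exact ⟨_, a, d, le_rfl, rfl, rfl, .comp h₁ h₂ ⟨h.1, h.2, hm⟩⟩

theorem Leaves.absorb (hF : Leaves F P Z M S T) (hP : Anterior P Z)
    (hT : ∀ i j, P i j → j ∈ T → i ∈ T) (hST : S ⊆ T) {a b c d : Bool × Bool} {i p j : V}
    {n₁ n₂ : ℕ} (h₁ : SCl F (StuckPass P N M S M₁ T) n₁ a b i p)
    (h₂ : SCl F (StuckPass P N M S M₁ T) n₂ c d p j)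
    (h : (p ∈ N ∧ AgPass P M₁ T b.1 c.1 p i j) ∨ RgPass M S b.1 c.1 p) :
    ∃ n' a' d', a'.1 = a.1 ∧ d'.1 = d.1 ∧ SCl F (StuckPass P N M S M₁ T) n' a' d' i j := by
  have := hF.absorb_aux (N := N) (M₁ := M₁) hP hT hST (n₁ + n₂) n₁ n₂ a b c d i p j le_rfl h₁ h₂
  rcases h with h | h
  · obtain ⟨n', a', d', -, h⟩ := this.1 h
    exact ⟨n', a', d', h⟩
  · obtain ⟨n', a', d', -, h⟩ := this.2 (.inl h)
    exact ⟨n', a', d', h⟩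

/-- The closure in which all nodes are eliminated at once is contained in the closure of the
leaves, in which the nodes of `M` and `S` outside `N` have already been eliminated. -/
theorem Leaves.of_closure (hF : Leaves F P Z M S T) (hP : Anterior P Z)
    (hT : ∀ i j, P i j → j ∈ T → i ∈ T) (hST : S ⊆ T) {E : Bool → Bool → V → V → Prop}
    (hE : Compat E P Z) (hM₁ : M₁ ⊆ N)
    (hbase : ∀ a b i j, E a b i j → ∃ a' b', a'.1 = a ∧ b'.1 = b ∧ F a' b' i j)
    (hnode : ∀ a b i j, E a b i j → j ∈ N ∨ j ∈ M ∨ j ∈ S)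
    (hTN : ∀ i ∈ T, i ∈ M → i ∉ S → ∃ t ∈ T, t ∈ N ∧ P i t)
    (hdet : ∀ m t, m ∈ M → m ∉ S → P m t → ∃ p a b, a.1 = false ∧ b.1 = true ∧ F a b m p ∧
      P m p ∧ (p = t ∨ p ∈ N ∧ P p t))
    {a b : Bool} {i j : V} (h : Cl E (AgPass P (M ∪ M₁) T) a b i j) :
    ∃ n a' b', a'.1 = a ∧ b'.1 = b ∧ SCl F (StuckPass P N M S M₁ T) n a' b' i j := by
  have sy := @SCl.symm _ _ F (StuckPass P N M S M₁ T) hF.symm (fun _ _ _ _ _ h => h.symm)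
  -- Eliminate a collider `m` that is an ancestor of `t` by passing through `p`.
  have detour : ∀ {a b c d : Bool × Bool} {i m j t : V} {n₁ n₂ : ℕ}, b.1 = true → c.1 = true →
      SCl F (StuckPass P N M S M₁ T) n₁ a b i m → SCl F (StuckPass P N M S M₁ T) n₂ c d m j →
      m ∈ M → m ∉ S → P m t → ∃ p n₁' a' b' n₂' c' d', SCl F (StuckPass P N M S M₁ T) n₁' a' b' i p ∧
        SCl F (StuckPass P N M S M₁ T) n₂' c' d' p j ∧ a'.1 = a.1 ∧ d'.1 = d.1 ∧
        b'.1 = true ∧ c'.1 = true ∧ (p = t ∨ p ∈ N ∧ P p t) := by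
    intro a b c d i m j t n₁ n₂ hb hc h₁ h₂ hmM hmS hmt
    obtain ⟨p, e, f, he, hf, hmp, -, hp⟩ := hdet m t hmM hmS hmt
    obtain ⟨n₁', a', b', ha', hb', h₁'⟩ := hF.absorb hP hT hST h₁ (.base hmp)
      (.inr (.inr ⟨.inr he, hmM⟩))
    obtain ⟨n₂', c', d', hc', hd', h₂'⟩ := hF.absorb hP hT hST (sy (.base hmp)) h₂
      (.inr (.inr ⟨.inl he, hmM⟩))
    exact ⟨p, n₁', a', b', n₂', c', d', h₁', h₂', ha', hd', hb'.trans hf, hc'.trans hf, hp⟩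
  have hnode' : ∀ {a b i j}, Cl E (AgPass P (M ∪ M₁) T) a b i j → j ∈ N ∨ j ∈ M ∨ j ∈ S := by
    intro a b i j h
    induction h with
    | base h => exact hnode _ _ _ _ h
    | comp _ _ _ _ ih => exact ih
  induction h with
  | base h =>
    obtain ⟨a', b', ha, hb, h⟩ := hbase _ _ _ _ h
    exact ⟨1, a', b', ha, hb, .base h⟩
  | @comp a b c d i m j hl hr h ih₁ ih₂ =>
    obtain ⟨n₁, a', b', rfl, rfl, h₁⟩ := ih₁
    obtain ⟨n₂, c', d', rfl, rfl, h₂⟩ := ih₂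
    by_cases hm : (m ∈ N ∧ AgPass P M₁ T b'.1 c'.1 m i j) ∨ RgPass M S b'.1 c'.1 m
    · exact hF.absorb hP hT hST h₁ h₂ hm
    have hN := hnode' hl
    have tl₁ := hl.tailOf hP hE hT (fun _ _ _ _ _ h => h)
    have tl₂ := hr.tailOf hP hE hT (fun _ _ _ _ _ h => h)
    have hd₁ := hl.headOf hE
    have hm₁ := @hM₁ m
    have hx : b'.1 = true ∧ c'.1 = true ∧ m ∉ N ∧ m ∈ M ∧ m ∉ S ∧ (m ∈ T ∨ P m i ∨ P m j) := by
      unfold AgPass RgPass at *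
      simp only [Set.mem_union] at h
      grind
    clear hm
    obtain ⟨hb, hc, hmN, hmM, hmS, hx⟩ := hx
    by_cases hmT : m ∈ T
    · obtain ⟨t, htT, htN, hmt⟩ := hTN m hmT hmM hmS
      obtain ⟨p, k₁, a₁, b₁, k₂, c₁, d₁, h₁', h₂', ha, hd, hb₁, hc₁, hp⟩ :=
        detour hb hc h₁ h₂ hmM hmS hmt
      have hp' : p ∈ N ∧ p ∈ T := by
        rcases hp with rfl | hp
        · exact ⟨htN, htT⟩
        · exact ⟨hp.1, hT _ _ hp.2 htT⟩
      rw [← ha, ← hd]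
      exact hF.absorb hP hT hST h₁' h₂' (.inl ⟨hp'.1, .inl ⟨hb₁, hc₁, .inl hp'.2⟩⟩)
    have hmZ := hd₁.2 hb
    rcases hx with hx | hx | hx
    · exact absurd hx hmT
    · obtain ⟨p, k₁, a₁, b₁, k₂, c₁, d₁, h₁', h₂', ha, hd, hb₁, hc₁, hp⟩ :=
        detour hb hc h₁ h₂ hmM hmS hx
      rw [← ha, ← hd]
      rcases hp with rfl | hp
      · refine ⟨k₂, c₁, d₁, ?_, rfl, h₂'⟩
        rw [hc₁, ha]
        by_contra hne
        have : a'.1 = false := by simpa using Ne.symm hne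
        have := tl₁.1 this
        have t := hP.trans
        have r := hP.irrefl
        have z := hP.closed
        grind
      · exact hF.absorb hP hT hST h₁' h₂' (.inl ⟨hp.1, .inl ⟨hb₁, hc₁, .inr (.inl hp.2)⟩⟩)
    · obtain ⟨p, k₁, a₁, b₁, k₂, c₁, d₁, h₁', h₂', ha, hd, hb₁, hc₁, hp⟩ :=
        detour hb hc h₁ h₂ hmM hmS hx
      rw [← ha, ← hd]
      rcases hp with rfl | hp
      · refine ⟨k₁, a₁, b₁, rfl, ?_, h₁'⟩
        rw [hb₁, hd]
        by_contra hne
        have : d'.1 = false := by simpa using Ne.symm hne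
        have := tl₂.2 this
        have t := hP.trans
        have r := hP.irrefl
        have z := hP.closed
        grind
      · exact hF.absorb hP hT hST h₁' h₂' (.inl ⟨hp.1, .inl ⟨hb₁, hc₁, .inr (.inr hp.2)⟩⟩)

end Absorb

/-! ### Labelled edges of mixed graphs -/

/-- The labelled edge relation of a mixed graph: `true` marks an arrowhead at the endpoint. -/
def MixedGraph.edge (G : MixedGraph V) : Bool → Bool → V → V → Prop
  | false, false, i, j => G.line i j
  | false, true, i, j => G.arrow i j
  | true, false, i, j => G.arrow j i
  | true, true, i, j => G.arc i j

theorem MixedGraph.ext_edge {G G' : MixedGraph V} (hn : G.nodes = G'.nodes)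
    (he : ∀ a b i j, G.edge a b i j ↔ G'.edge a b i j) : G = G' := by
  obtain ⟨n, r, c, l⟩ := G
  obtain ⟨n', r', c', l'⟩ := G'
  have h₁ : r = r' := by ext i j; exact he false true i j
  have h₂ : c = c' := by ext i j; exact he true true i j
  have h₃ : l = l' := by ext i j; exact he false false i j
  simp only at hn
  subst hn h₁ h₂ h₃
  rfl

/-- The properties of summary graphs used for the AG-generating map. -/
structure IsSummary (G : MixedGraph V) : Prop where
  wf : G.Wf
  loopless : G.Loopless
  line_head : ∀ i, G.LineEndpoint i → ∀ k, ¬ G.arrow k i ∧ ¬ G.arc k i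
  acyclic : ∀ i, ¬ G.anc i i

theorem MixedGraph.IsAG.isSummary {G : MixedGraph V} (h : G.IsAG) : IsSummary G where
  wf := h.1
  loopless := h.2.1.1
  line_head := h.2.2.2.2
  acyclic i hi := by
    obtain ⟨k, hik, hki⟩ := Relation.TransGen.tail'_iff.1 hi
    rcases Relation.reflTransGen_iff_eq_or_transGen.1 hik with rfl | hik
    · exact (h.2.1.1 _).1 hki
    · exact h.2.2.2.1 i k (.inl hki) hik

/-- The nodes at which the AG-generating map leaves no arrowheads. -/
def MixedGraph.zone (G : MixedGraph V) (C : Set V) : Set V :=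
  {i | G.LineEndpoint i ∨ i ∈ C ∪ G.anSet C}

theorem MixedGraph.anSet_closed (G : MixedGraph V) {C : Set V} {i j : V} (hij : G.anc i j)
    (hj : j ∈ C ∪ G.anSet C) : i ∈ C ∪ G.anSet C := by
  rcases hj with hj | ⟨c, hc, hj⟩
  · exact .inr ⟨j, hj, hij⟩
  · exact .inr ⟨c, hc, hij.trans hj⟩

section Summary

variable {G : MixedGraph V}

theorem IsSummary.edge_symm (hG : IsSummary G) (a b : Bool) (i j : V) (h : G.edge a b i j) :
    G.edge b a j i := by
  cases a <;> cases b
  · exact hG.wf.2.1 _ _ h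
  · exact h
  · exact h
  · exact hG.wf.1 _ _ h

theorem IsSummary.edge_nodes (hG : IsSummary G) (a b : Bool) (i j : V) (h : G.edge a b i j) :
    i ∈ G.nodes ∧ j ∈ G.nodes := by
  have := hG.wf.2.2
  cases a <;> cases b
  · exact this _ _ (.inr (.inr h))
  · exact this _ _ (.inl h)
  · exact (this _ _ (.inl h)).symm
  · exact this _ _ (.inr (.inl h))

theorem IsSummary.not_anc_line (hG : IsSummary G) {i j : V} (h : G.anc i j) :
    ¬ G.LineEndpoint j := by
  obtain ⟨k, -, hk⟩ := Relation.TransGen.tail'_iff.1 h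
  exact fun hj => (hG.line_head j hj k).1 hk

theorem IsSummary.anc_nodes (hG : IsSummary G) {i j : V} (h : G.anc i j) :
    i ∈ G.nodes ∧ j ∈ G.nodes := by
  obtain ⟨k, -, hk⟩ := Relation.TransGen.tail'_iff.1 h
  obtain ⟨l, hl, -⟩ := Relation.TransGen.head'_iff.1 h
  exact ⟨(hG.edge_nodes false true _ _ hl).1, (hG.edge_nodes false true _ _ hk).2⟩

theorem IsSummary.anterior (hG : IsSummary G) (C : Set V) : Anterior G.anc (G.zone C) where
  trans _ _ _ := Relation.TransGen.trans
  irrefl := hG.acyclic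
  closed i j hij hj := by
    rcases hj with hj | hj
    · exact absurd hj (hG.not_anc_line hij)
    · exact .inr (G.anSet_closed hij hj)

theorem IsSummary.anterior_line (hG : IsSummary G) :
    Anterior G.anc {i | G.LineEndpoint i} where
  trans _ _ _ := Relation.TransGen.trans
  irrefl := hG.acyclic
  closed _ _ hij hj := absurd hj (hG.not_anc_line hij)

theorem IsSummary.compat (hG : IsSummary G) :
    Compat G.edge G.anc {i | G.LineEndpoint i} where
  symm := hG.edge_symm
  tail b i j h := by
    cases b
    · exact .inl ⟨j, h⟩
    · exact .inr (.single h)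
  head b i j h hi := by
    have := hG.line_head i hi j
    cases b
    · exact this.1 h
    · exact this.2 (hG.wf.1 _ _ h)

end Summary

/-- The inner nodes of the RG-generating algorithm, for distinct endpoints. -/
abbrev RgStep (M S : Set V) (b c : Bool) (m i j : V) : Prop := i ≠ j ∧ RgPass M S b c m

section Gen

variable {H : MixedGraph V} {M S : Set V}

mutual
  theorem GenArrow.cl (hH : IsSummary H) {i j : V} :
      GenArrow H M S i j → Cl H.edge (RgStep M S) false true i j
    | .base h => .base h
    | .row1 hm hij h₁ h₂ => .comp (h₁.cl hH) (h₂.cl hH) ⟨hij, .inr ⟨.inr rfl, hm⟩⟩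
    | .row2 hm hij h₁ h₂ => .comp (h₁.cl hH) (h₂.cl hH) ⟨hij, .inr ⟨.inl rfl, hm⟩⟩
    | .row3 hm hij h₁ h₂ => .comp (h₁.cl hH) (h₂.cl hH) ⟨hij, .inr ⟨.inl rfl, hm⟩⟩
    | .row8 hm hij h₁ h₂ => .comp (h₁.cl hH) (h₂.cl hH) ⟨hij, .inl ⟨rfl, rfl, hm⟩⟩

  theorem GenArc.cl (hH : IsSummary H) {i j : V} :
      GenArc H M S i j → Cl H.edge (RgStep M S) true true i j
    | .base h => .base h
    | .symm h => (h.cl hH).symm hH.edge_symm (fun _ _ _ _ _ h => ⟨h.1.symm, h.2.symm⟩)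
    | .row4 hm hij h₁ h₂ => .comp ((h₁.cl hH).symm hH.edge_symm
        (fun _ _ _ _ _ h => ⟨h.1.symm, h.2.symm⟩)) (h₂.cl hH) ⟨hij, .inr ⟨.inl rfl, hm⟩⟩
    | .row5 hm hij h₁ h₂ => .comp ((h₁.cl hH).symm hH.edge_symm
        (fun _ _ _ _ _ h => ⟨h.1.symm, h.2.symm⟩)) (h₂.cl hH) ⟨hij, .inr ⟨.inl rfl, hm⟩⟩
    | .row9 hm hij h₁ h₂ => .comp (h₁.cl hH) (h₂.cl hH) ⟨hij, .inl ⟨rfl, rfl, hm⟩⟩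

  theorem GenLine.cl (hH : IsSummary H) {i j : V} :
      GenLine H M S i j → Cl H.edge (RgStep M S) false false i j
    | .base h => .base h
    | .symm h => (h.cl hH).symm hH.edge_symm (fun _ _ _ _ _ h => ⟨h.1.symm, h.2.symm⟩)
    | .row6 hm hij h₁ h₂ => .comp (h₁.cl hH) ((h₂.cl hH).symm hH.edge_symm
        (fun _ _ _ _ _ h => ⟨h.1.symm, h.2.symm⟩)) ⟨hij, .inr ⟨.inl rfl, hm⟩⟩
    | .row7 hm hij h₁ h₂ => .comp (h₁.cl hH) (h₂.cl hH) ⟨hij, .inr ⟨.inl rfl, hm⟩⟩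
    | .row10 hm hij h₁ h₂ => .comp (h₁.cl hH) ((h₂.cl hH).symm hH.edge_symm
        (fun _ _ _ _ _ h => ⟨h.1.symm, h.2.symm⟩)) ⟨hij, .inl ⟨rfl, rfl, hm⟩⟩
end

/-- The graph of all edges generated by the RG-generating algorithm. -/
def genGraph (H : MixedGraph V) (M S : Set V) : MixedGraph V where
  nodes := H.nodes
  arrow := GenArrow H M S
  arc := GenArc H M S
  line := GenLine H M S

theorem genGraph_edge_comp {a b c d : Bool} {i m j : V} (h₁ : (genGraph H M S).edge a b i m)
    (h₂ : (genGraph H M S).edge c d m j) (h : RgStep M S b c m i j) :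
    (genGraph H M S).edge a d i j := by
  obtain ⟨hij, h | ⟨h, hm⟩⟩ := h
  · obtain ⟨rfl, rfl, hm⟩ := h
    cases a <;> cases d
    · exact GenLine.row10 hm hij h₁ h₂
    · exact GenArrow.row8 hm hij h₁ h₂
    · exact GenArrow.row8 hm hij.symm h₂ (GenArc.symm h₁)
    · exact GenArc.row9 hm hij h₁ h₂
  · cases b
    · cases a <;> cases c <;> cases d
      · exact GenLine.row7 hm hij h₁ h₂
      · exact GenArrow.row2 hm hij h₁ h₂
      · exact GenLine.row6 hm hij h₁ h₂
      · exact GenArrow.row3 hm hij h₁ h₂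
      · exact GenArrow.row2 hm hij.symm (GenLine.symm h₂) h₁
      · exact GenArc.row4 hm hij h₁ h₂
      · exact GenArrow.row1 hm hij.symm h₂ h₁
      · exact GenArc.row5 hm hij h₁ h₂
    · have hc : c = false := by simpa using h
      subst hc
      cases a <;> cases d
      · exact GenLine.symm (GenLine.row6 hm hij.symm (GenLine.symm h₂) h₁)
      · exact GenArrow.row1 hm hij h₁ h₂
      · exact GenArrow.row3 hm hij.symm (GenLine.symm h₂) (GenArc.symm h₁)
      · exact GenArc.symm (GenArc.row5 hm hij.symm h₂ (GenArc.symm h₁))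

theorem genGraph_edge (hH : IsSummary H) {a b : Bool} {i j : V} :
    (genGraph H M S).edge a b i j ↔ Cl H.edge (RgStep M S) a b i j := by
  constructor
  · intro h
    cases a <;> cases b
    · exact GenLine.cl hH h
    · exact GenArrow.cl hH h
    · exact (GenArrow.cl hH h).symm hH.edge_symm (fun _ _ _ _ _ h => ⟨h.1.symm, h.2.symm⟩)
    · exact GenArc.cl hH h
  · intro h
    induction h with
    | @base a b i j h =>
      cases a <;> cases b
      · exact GenLine.base h
      · exact GenArrow.base h
      · exact GenArrow.base h
      · exact GenArc.base h
    | comp _ _ h ih₁ ih₂ => exact genGraph_edge_comp ih₁ ih₂ h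

theorem genGraph_symm {a b : Bool} {i j : V} (h : (genGraph H M S).edge a b i j) :
    (genGraph H M S).edge b a j i := by
  cases a <;> cases b
  · exact GenLine.symm h
  · exact h
  · exact h
  · exact GenArc.symm h

end Gen

theorem deheadAt_edge {K : MixedGraph V} {A : Set V}
    (hK : ∀ a b i j, K.edge a b i j → K.edge b a j i) {a b : Bool} {i j : V} :
    (deheadAt K A).edge a b i j ↔
      ∃ a₀ b₀, K.edge a₀ b₀ i j ∧ (a = true ↔ a₀ = true ∧ i ∉ A) ∧
        (b = true ↔ b₀ = true ∧ j ∉ A) := by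
  have s : K.arc i j ↔ K.arc j i := ⟨hK true true i j, hK true true j i⟩
  by_cases hi : i ∈ A <;> by_cases hj : j ∈ A <;> cases a <;> cases b <;>
    simp [MixedGraph.edge, deheadAt, hi, hj, Bool.exists_bool, s, or_assoc, or_comm,
      or_left_comm]

theorem alphaRG_edge {H : MixedGraph V} {M C : Set V} {a b : Bool} {i j : V} :
    (alphaRG H M C).edge a b i j ↔ i ∈ H.nodes \ (M ∪ C) ∧ j ∈ H.nodes \ (M ∪ C) ∧
      (genGraph H M (C ∪ H.anSet C)).edge a b i j := by
  cases a <;> cases b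
  · exact Iff.rfl
  · exact Iff.rfl
  · exact and_left_comm
  · exact Iff.rfl

/-- Edges of the graph generated by the SG-generating map. -/
theorem alphaSG_edge {H : MixedGraph V} (hH : IsSummary H) {M C : Set V} {a b : Bool} {i j : V} :
    (alphaSG H M C).edge a b i j ↔ i ∈ H.nodes \ (M ∪ C) ∧ j ∈ H.nodes \ (M ∪ C) ∧
      ∃ a₀ b₀, Cl H.edge (RgStep M (C ∪ H.anSet C)) a₀ b₀ i j ∧
        (a = true ↔ a₀ = true ∧ i ∉ C ∪ H.anSet C) ∧
        (b = true ↔ b₀ = true ∧ j ∉ C ∪ H.anSet C) := by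
  have mem : ∀ k ∈ H.nodes \ (M ∪ C), (k ∈ C ∪ H.anSet C ↔ k ∈ H.anSet C) := fun k hk =>
    or_iff_right fun h => hk.2 (.inr h)
  simp only [← genGraph_edge hH]
  rw [alphaSG, deheadAt_edge]
  · constructor
    · rintro ⟨a₀, b₀, h, ha, hb⟩
      obtain ⟨hi, hj, h⟩ := alphaRG_edge.1 h
      exact ⟨hi, hj, a₀, b₀, h, by rwa [mem i hi], by rwa [mem j hj]⟩
    · rintro ⟨hi, hj, a₀, b₀, h, ha, hb⟩
      rw [mem i hi] at ha
      rw [mem j hj] at hb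
      exact ⟨a₀, b₀, alphaRG_edge.2 ⟨hi, hj, h⟩, ha, hb⟩
  · intro a b i j h
    obtain ⟨hi, hj, h⟩ := alphaRG_edge.1 h
    exact alphaRG_edge.2 ⟨hj, hi, genGraph_symm h⟩

/-! ### The AG-generating map in terms of ancestors -/

/-- The inner nodes of step 2 of the AG-generating algorithm. -/
abbrev AgStep (P : V → V → Prop) (b c : Bool) (m i j : V) : Prop :=
  i ≠ j ∧ b = true ∧ c = true ∧ (P m i ∨ P m j)

/-- The adjacencies obtained by eliminating `M` and `C`. -/
abbrev AgCl (H : MixedGraph V) (M C : Set V) : Bool → Bool → V → V → Prop :=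
  Cl H.edge (AgPass H.anc M (C ∪ H.anSet C))

/-- The ancestral label at `i` of an edge between `i` and `j`. -/
abbrev AgLabel (P : V → V → Prop) (Z : Set V) (a : Bool) (i j : V) : Prop :=
  a = true ↔ i ∉ Z ∧ ¬ P i j

theorem exists_bool_iff (p : Prop) : ∃ a : Bool, a = true ↔ p := by
  classical exact ⟨decide p, decide_eq_true_iff⟩

section Steps

variable {K : MixedGraph V}

mutual
  theorem AG2Arrow.anc {i j : V} : AG2Arrow K i j → K.anc i j
    | .base h => .single h
    | .gen _ h₁ _ h₂ => h₁.anc.trans h₂.anc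

  theorem AG2Anc.anc {i j : V} : AG2Anc K i j → K.anc i j
    | .single h => h.anc
    | .tail h₁ h₂ => h₁.anc.trans h₂.anc
end

theorem AG2Anc.of_anc {i j : V} (h : K.anc i j) : AG2Anc K i j := by
  induction h using Relation.TransGen.head_induction_on with
  | single h => exact .single (.base h)
  | head h _ ih => exact .tail (.base h) ih

mutual
  theorem AG3Arrow.anc {i j : V} : AG3Arrow (ag2 K) i j → K.anc i j
    | .base h => AG2Arrow.anc h
    | .conv _ h => h.anc

  theorem AG3Anc.anc {i j : V} : AG3Anc (ag2 K) i j → K.anc i j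
    | .single h => h.anc
    | .tail h₁ h₂ => h₁.anc.trans h₂.anc
end

theorem AG3Anc.of_anc {i j : V} (h : K.anc i j) : AG3Anc (ag2 K) i j := by
  induction h using Relation.TransGen.head_induction_on with
  | single h => exact .single (.base (AG2Arrow.base h))
  | head h _ ih => exact .tail (.base (AG2Arrow.base h)) ih

variable {P : V → V → Prop} {Z : Set V}

theorem AgStep.symm {b c : Bool} {m i j : V} (h : AgStep P b c m i j) : AgStep P c b m j i :=
  ⟨h.1.symm, h.2.2.1, h.2.1, h.2.2.2.symm⟩

theorem AgStep.agPass {M S : Set V} {b c : Bool} {m i j : V} (h : AgStep P b c m i j) :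
    AgPass P M S b c m i j :=
  .inl ⟨h.2.1, h.2.2.1, .inr h.2.2.2⟩

mutual
  theorem AG2Arrow.cl (hK : Compat K.edge P Z) (hA : ∀ i j, i ∉ Z → K.anc i j → P i j) {i j : V} :
      AG2Arrow K i j → Cl K.edge (AgStep P) false true i j
    | .base h => .base h
    | .gen hij h₁ h₂ h₃ => .comp (h₁.cl hK hA) (h₂.cl hK hA) ⟨hij, rfl, rfl,
        .inr (hA _ _ (((h₂.cl hK hA).headOf hK).1 rfl) h₃.anc)⟩

  theorem AG2Arc.cl (hK : Compat K.edge P Z) (hA : ∀ i j, i ∉ Z → K.anc i j → P i j) {i j : V} :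
      AG2Arc K i j → Cl K.edge (AgStep P) true true i j
    | .base h => .base h
    | .symm h => (h.cl hK hA).symm hK.symm (fun _ _ _ _ _ h => h.symm)
    | .gen hij h₁ h₂ h₃ => .comp (h₁.cl hK hA) (h₂.cl hK hA) ⟨hij, rfl, rfl,
        .inr (hA _ _ (((h₂.cl hK hA).headOf hK).1 rfl) h₃.anc)⟩
end

theorem ag2_edge_symm (hK : ∀ a b i j, K.edge a b i j → K.edge b a j i) {a b : Bool} {i j : V}
    (h : (ag2 K).edge a b i j) : (ag2 K).edge b a j i := by
  cases a <;> cases b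
  · exact hK false false _ _ h
  · exact h
  · exact h
  · exact AG2Arc.symm h

theorem ag2_edge (hP : Anterior P Z) (hK : Compat K.edge P Z)
    (hA : ∀ i j, i ∉ Z → K.anc i j → P i j)
    (hA' : ∀ a b i j, K.edge a b i j → j ∉ Z → ∀ c d k l, K.edge c d k l → P j l → K.anc j l)
    {a b : Bool} {i j : V} : (ag2 K).edge a b i j ↔ Cl K.edge (AgStep P) a b i j := by
  constructor
  · intro h
    cases a <;> cases b
    · exact .base h
    · exact AG2Arrow.cl hK hA h
    · exact (AG2Arrow.cl hK hA h).symm hK.symm (fun _ _ _ _ _ h => h.symm)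
    · exact AG2Arc.cl hK hA h
  · intro h
    have last : ∀ {a b i j}, Cl K.edge (AgStep P) a b i j → ∃ a b i, K.edge a b i j := by
      intro a b i j h
      induction h with
      | @base a b i j h => exact ⟨a, b, i, h⟩
      | comp _ _ _ _ ih => exact ih
    have step : ∀ {a d : Bool} {i m j : V}, Cl K.edge (AgStep P) a true i m →
        Cl K.edge (AgStep P) true d m j → (ag2 K).edge a true i m → (ag2 K).edge true d m j →
        i ≠ j → P m j → (ag2 K).edge a d i j := by
      intro a d i m j h₁ h₂ h₁' h₂' hij hmj
      have hm := (h₂.headOf hK).1 rfl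
      have hd : d = true := by
        by_contra hd
        have := (h₂.tailOf (M := ∅) (S := ∅) hP hK (by simp)
          (fun _ _ _ _ _ h => h.agPass)).2 (by simpa using hd)
        rcases this with h | h | h
        · exact hm (hP.closed _ _ hmj h)
        · exact h
        · exact hP.irrefl _ (hP.trans _ _ _ h hmj)
      subst hd
      obtain ⟨a₁, b₁, i₁, e₁⟩ := last h₁
      obtain ⟨c₁, d₁, k₁, e₂⟩ := last h₂
      have anc := AG2Anc.of_anc (hA' _ _ _ _ e₁ hm _ _ _ _ e₂ hmj)
      cases a
      · exact AG2Arrow.gen hij h₁' h₂' anc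
      · exact AG2Arc.gen hij h₁' h₂' anc
    induction h with
    | @base a b i j h =>
      cases a <;> cases b
      · exact h
      · exact AG2Arrow.base h
      · exact AG2Arrow.base h
      · exact AG2Arc.base h
    | comp h₁ h₂ h ih₁ ih₂ =>
      obtain ⟨hij, rfl, rfl, h | h⟩ := h
      · exact ag2_edge_symm hK.symm (step (h₂.symm hK.symm fun _ _ _ _ _ h => h.symm)
          (h₁.symm hK.symm fun _ _ _ _ _ h => h.symm) (ag2_edge_symm hK.symm ih₂)
          (ag2_edge_symm hK.symm ih₁) hij.symm h)
      · exact step h₁ h₂ ih₁ ih₂ hij h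

theorem alphaSGAG_edge (hP : Anterior P Z) (hK : Compat K.edge P Z)
    (hA : ∀ i j, i ∉ Z → K.anc i j → P i j)
    (hA' : ∀ a b i j, K.edge a b i j → j ∉ Z → ∀ c d k l, K.edge c d k l → P j l → K.anc j l)
    {a b : Bool} {i j : V} : (alphaSGAG K).edge a b i j ↔
      (∃ a₀ b₀, Cl K.edge (AgStep P) a₀ b₀ i j) ∧ AgLabel P Z a i j ∧ AgLabel P Z b j i := by
  have facts : ∀ {a b i j}, (ag2 K).edge a b i j → ((a = true → i ∉ Z) ∧ (b = true → j ∉ Z)) ∧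
      (a = false → i ∈ Z ∨ P i j) ∧ (b = false → j ∈ Z ∨ P j i) ∧
      (i ∉ Z → P i j → AG3Anc (ag2 K) i j) ∧ (j ∉ Z → P j i → AG3Anc (ag2 K) j i) := by
    intro a b i j h
    rw [ag2_edge hP hK hA hA'] at h
    have t := h.tailOf (M := ∅) (S := ∅) hP hK (by simp) (fun _ _ _ _ _ h => h.agPass)
    simp only [Set.mem_empty_iff_false, false_or] at t
    have last : ∀ {a b i j}, Cl K.edge (AgStep P) a b i j → ∃ a b i, K.edge a b i j := by
      intro a b i j h
      induction h with
      | @base a b i j h => exact ⟨a, b, i, h⟩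
      | comp _ _ _ _ ih => exact ih
    obtain ⟨_, _, _, e₁⟩ := last h
    obtain ⟨_, _, _, e₂⟩ := last (h.symm hK.symm fun _ _ _ _ _ h => h.symm)
    exact ⟨h.headOf hK, t.1, t.2, fun hi hij => .of_anc (hA' _ _ _ _ e₂ hi _ _ _ _ e₁ hij),
      fun hi hij => .of_anc (hA' _ _ _ _ e₁ hi _ _ _ _ e₂ hij)⟩
  have anc : ∀ {i j}, i ∉ Z → AG3Anc (ag2 K) i j → P i j := fun hi h => hA _ _ hi h.anc
  have hK2 : (∃ a₀ b₀, Cl K.edge (AgStep P) a₀ b₀ i j) ↔ ∃ a₀ b₀, (ag2 K).edge a₀ b₀ i j := by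
    simp only [ag2_edge hP hK hA hA']
  rw [hK2]
  have t := hP.trans i j i
  have t' := hP.trans j i j
  have r := hP.irrefl
  have z := hP.closed i j
  have z' := hP.closed j i
  have arrow : ∀ {i j : V}, AG3Arrow (ag2 K) i j → (ag2 K).edge false true i j ∨
      ((ag2 K).edge true true i j ∧ P i j) := by
    rintro i j (h | ⟨h, h'⟩)
    · exact .inl h
    · exact .inr ⟨h, anc ((facts (a := true) (b := true) h).1.1 rfl) h'⟩
  constructor
  · intro h
    have : ∃ a₀ b₀, (ag2 K).edge a₀ b₀ i j ∧
        ((a₀ = a ∧ b₀ = b ∧ (a = true ∧ b = true → ¬ P i j ∧ ¬ P j i)) ∨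
          a₀ = true ∧ b₀ = true ∧ ((a = false ∧ b = true ∧ P i j) ∨
            (a = true ∧ b = false ∧ P j i))) := by
      cases a <;> cases b
      · exact ⟨false, false, h, by simp⟩
      · rcases arrow h with h | h
        · exact ⟨false, true, h, by simp⟩
        · exact ⟨true, true, h.1, by simp [h.2]⟩
      · rcases arrow h with h | h
        · exact ⟨true, false, h, by simp⟩
        · exact ⟨true, true, ag2_edge_symm (a := true) (b := true) hK.symm h.1, by simp [h.2]⟩
      · have f := facts (a := true) (b := true) h.1
        exact ⟨true, true, h.1, .inl ⟨rfl, rfl, fun _ => ⟨fun h' => h.2.1 (f.2.2.2.1 (f.1.1 rfl) h'),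
          fun h' => h.2.2 (f.2.2.2.2 (f.1.2 rfl) h')⟩⟩⟩
    obtain ⟨a₀, b₀, he, h⟩ := this
    refine ⟨⟨a₀, b₀, he⟩, ?_⟩
    obtain ⟨f₁, f₂, f₃, -⟩ := facts he
    have r₁ := r i
    have r₂ := r j
    clear facts anc arrow hA hA' hK hK2 r hP
    unfold AgLabel
    grind
  · rintro ⟨⟨a₀, b₀, he⟩, ha, hb⟩
    obtain ⟨f₁, f₂, f₃, f₄, f₅⟩ := facts he
    have r₁ := r i
    have r₂ := r j
    unfold AgLabel at ha hb
    have : (a₀ = a ∧ b₀ = b ∧ (a = true ∧ b = true → ¬ P i j ∧ ¬ P j i ∧ i ∉ Z ∧ j ∉ Z)) ∨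
          a₀ = true ∧ b₀ = true ∧ ((a = false ∧ b = true ∧ P i j ∧ i ∉ Z) ∨
            (a = true ∧ b = false ∧ P j i ∧ j ∉ Z)) := by
      clear facts anc arrow hA hA' hK hK2 r hP f₄ f₅
      grind
    rcases this with ⟨rfl, rfl, h⟩ | ⟨rfl, rfl, ⟨rfl, rfl, h, hi⟩ | ⟨rfl, rfl, h, hi⟩⟩
    · cases a₀ <;> cases b₀
      · exact he
      · exact AG3Arrow.base he
      · exact AG3Arrow.base he
      · obtain ⟨h₁, h₂, h₃, h₄⟩ := h ⟨rfl, rfl⟩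
        exact ⟨he, fun h' => h₁ (anc h₃ h'), fun h' => h₂ (anc h₄ h')⟩
    · exact AG3Arrow.conv he (f₄ hi h)
    · exact AG3Arrow.conv (AG2Arc.symm he) (f₅ hi h)

end Steps

section Eliminate

variable {H : MixedGraph V} {M C : Set V}

theorem Cl.ne {L : Type} {E : L → L → V → V → Prop} {pass : L → L → V → V → V → Prop}
    (hE : ∀ a b i j, E a b i j → i ≠ j) (hp : ∀ b c m i j, pass b c m i j → i ≠ j)
    {a b : L} {i j : V} (h : Cl E pass a b i j) : i ≠ j := by
  cases h with
  | base h => exact hE _ _ _ _ h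
  | comp _ _ h => exact hp _ _ _ _ _ h

theorem Cl.flatten {L : Type} {E : L → L → V → V → Prop}
    {pass₁ pass₂ pass : L → L → V → V → V → Prop}
    (h₁ : ∀ b c m i j, pass₁ b c m i j → pass b c m i j)
    (h₂ : ∀ b c m i j, pass₂ b c m i j → pass b c m i j)
    {a b : L} {i j : V} (h : Cl (Cl E pass₁) pass₂ a b i j) : Cl E pass a b i j := by
  induction h with
  | base h => exact h.mono (fun _ _ _ _ h => h) h₁
  | comp _ _ h ih₁ ih₂ => exact .comp ih₁ ih₂ (h₂ _ _ _ _ _ h)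

theorem IsSummary.edge_ne (hH : IsSummary H) (a b : Bool) (i j : V) (h : H.edge a b i j) :
    i ≠ j := by
  rintro rfl
  have := hH.loopless i
  cases a <;> cases b
  · exact this.2.2 h
  · exact this.1 h
  · exact this.1 h
  · exact this.2.1 h

theorem AgCl.tail (hH : IsSummary H) {a b : Bool} {i j : V} (h : AgCl H M C a b i j) :
    (a = false → i ∈ H.zone C ∨ H.anc i j) ∧ (b = false → j ∈ H.zone C ∨ H.anc j i) := by
  have := h.tailOf (hH.anterior_line) hH.compat (fun _ _ => H.anSet_closed)
    (fun _ _ _ _ _ h => h)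
  simpa only [MixedGraph.zone, Set.mem_ofPred_eq, or_assoc] using this

theorem AgCl.head (hH : IsSummary H) {a b : Bool} {i j : V} (h : AgCl H M C a b i j) :
    (a = true → ¬ H.LineEndpoint i) ∧ (b = true → ¬ H.LineEndpoint j) :=
  h.headOf hH.compat

theorem AgCl.symm (hH : IsSummary H) {a b : Bool} {i j : V} (h : AgCl H M C a b i j) :
    AgCl H M C b a j i :=
  Cl.symm hH.edge_symm (fun _ _ _ _ _ h' => h'.symm) h

theorem Cl.rgStep_agCl {a b : Bool} {i j : V}
    (h : Cl H.edge (RgStep M (C ∪ H.anSet C)) a b i j) : AgCl H M C a b i j :=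
  h.mono (fun _ _ _ _ h => h) fun _ _ _ _ _ h => h.2.agPass

theorem alphaSG_compat (hH : IsSummary H) :
    Compat (alphaSG H M C).edge H.anc (H.zone C) where
  symm a b i j h := by
    obtain ⟨hi, hj, a₀, b₀, h, ha, hb⟩ := (alphaSG_edge hH).1 h
    exact (alphaSG_edge hH).2 ⟨hj, hi, b₀, a₀, h.symm hH.edge_symm
      (fun _ _ _ _ _ h => ⟨h.1.symm, h.2.symm⟩), hb, ha⟩
  tail b i j h := by
    obtain ⟨hi, hj, a₀, b₀, h, ha, hb⟩ := (alphaSG_edge hH).1 h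
    cases a₀
    · exact (AgCl.tail hH h.rgStep_agCl).1 rfl
    · by_contra hi
      exact Bool.false_ne_true (ha.2 ⟨rfl, fun h => hi (.inl (.inr h))⟩)
  head b i j h := by
    obtain ⟨hi, hj, a₀, b₀, h, ha, hb⟩ := (alphaSG_edge hH).1 h
    have := ha.1 rfl
    rintro (hi | hi)
    · exact (AgCl.head hH h.rgStep_agCl).1 this.1 hi
    · exact this.2 hi

theorem alphaSG_anc (hH : IsSummary H) {i j : V} (hi : i ∉ H.zone C)
    (h : (alphaSG H M C).anc i j) : H.anc i j := by
  have hK := alphaSG_compat (M := M) (C := C) hH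
  induction h using Relation.TransGen.head_induction_on with
  | single h => exact (hK.tail true _ _ h).resolve_left hi
  | @head i k h _ ih =>
    exact ((hK.tail true _ _ h).resolve_left hi).trans
      (ih (hK.head false _ _ (hK.symm false true _ _ h)))

theorem alphaSG_arrow (hH : IsSummary H) {i j : V} (hi : i ∈ H.nodes \ (M ∪ C))
    (hj : j ∈ H.nodes \ (M ∪ C)) (hjS : j ∉ C ∪ H.anSet C)
    (h : Cl H.edge (RgStep M (C ∪ H.anSet C)) false true i j) : (alphaSG H M C).arrow i j :=
  (alphaSG_edge (a := false) (b := true) hH).2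
    ⟨hi, hj, false, true, h, by simp, by simpa using hjS⟩

/-- The first node outside `M` on a direction-preserving path. -/
theorem exists_generated_arrow (hH : IsSummary H) {i j : V} (h : H.anc i j)
    (hi : i ∉ C ∪ H.anSet C) :
    ∃ p, Cl H.edge (RgStep M (C ∪ H.anSet C)) false true i p ∧ H.anc i p ∧
      (p = j ∨ (p ∈ H.nodes \ (M ∪ C) ∧ H.anc p j ∧
        (j ∈ H.nodes \ (M ∪ C) → (alphaSG H M C).anc p j))) := by
  induction h using Relation.TransGen.head_induction_on with
  | single h => exact ⟨j, .base h, .single h, .inl rfl⟩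
  | @head i k h hkj ih =>
    have hk : k ∉ C ∪ H.anSet C := fun hk => hi (H.anSet_closed (.single h) hk)
    obtain ⟨p, hp, hkp, hpj⟩ := ih hk
    by_cases hkM : k ∈ M
    · have hip : H.anc i p := .head h hkp
      refine ⟨p, .comp (.base (a := false) (b := true) h) hp ⟨?_, .inr ⟨.inr rfl, hkM⟩⟩, hip, hpj⟩
      rintro rfl
      exact hH.acyclic _ hip
    · have hkN : k ∈ H.nodes \ (M ∪ C) :=
        ⟨(hH.anc_nodes hkj).1, fun h' => h'.elim hkM fun h' => hk (.inl h')⟩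
      have hpS : p ∉ C ∪ H.anSet C := fun hp => hk (H.anSet_closed hkp hp)
      refine ⟨k, .base h, .single h, .inr ⟨hkN, hkj, fun hj => ?_⟩⟩
      rcases hpj with rfl | ⟨hpN, -, hpj⟩
      · exact .single (alphaSG_arrow hH hkN hj hpS hp)
      · exact .head (alphaSG_arrow hH hkN hpN hpS hp) (hpj hj)

theorem alphaSG_anc_of_anc (hH : IsSummary H) {i j : V} (hi : i ∉ C ∪ H.anSet C)
    (hiN : i ∈ H.nodes \ (M ∪ C)) (hjN : j ∈ H.nodes \ (M ∪ C)) (h : H.anc i j) :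
    (alphaSG H M C).anc i j := by
  obtain ⟨p, hp, hip, hpj⟩ := exists_generated_arrow (M := M) hH h hi
  have hpS : p ∉ C ∪ H.anSet C := fun hp => hi (H.anSet_closed hip hp)
  rcases hpj with rfl | ⟨hpN, -, hpj⟩
  · exact .single (alphaSG_arrow hH hiN hjN hpS hp)
  · exact .head (alphaSG_arrow hH hiN hpN hpS hp) (hpj hjN)

theorem AgCl.of_alphaSG (hH : IsSummary H) {a b : Bool} {i j : V}
    (h : Cl (alphaSG H M C).edge (AgStep H.anc) a b i j) :
    i ∈ H.nodes \ (M ∪ C) ∧ j ∈ H.nodes \ (M ∪ C) ∧ i ≠ j ∧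
      ∃ a₀ b₀, AgCl H M C a₀ b₀ i j ∧ (a = true → a₀ = true) ∧ (b = true → b₀ = true) := by
  induction h with
  | base h =>
    obtain ⟨hi, hj, a₀, b₀, h, ha, hb⟩ := (alphaSG_edge hH).1 h
    exact ⟨hi, hj, h.ne hH.edge_ne fun _ _ _ _ _ h => h.1, a₀, b₀, h.rgStep_agCl,
      fun h => (ha.1 h).1, fun h => (hb.1 h).1⟩
  | comp _ _ h ih₁ ih₂ =>
    obtain ⟨hi, -, -, a₀, b₀, h₁, ha, hb⟩ := ih₁
    obtain ⟨-, hj, -, c₀, d₀, h₂, hc, hd⟩ := ih₂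
    exact ⟨hi, hj, h.1, a₀, d₀,
      .comp h₁ h₂ (.inl ⟨hb h.2.1, hc h.2.2.1, .inr h.2.2.2⟩), ha, hd⟩

/-- The edges generated by the RG-generating algorithm, loops allowed. -/
abbrev RgCl (H : MixedGraph V) (M C : Set V) : Bool → Bool → V → V → Prop :=
  Cl H.edge (fun b c m _ _ => RgPass M (C ∪ H.anSet C) b c m)

/-- Inner nodes outside `M` and the ancestors of `C`. -/
abbrev AncPass (H : MixedGraph V) (M C : Set V) (b c : Bool) (m i j : V) : Prop :=
  b = true ∧ c = true ∧ m ∈ H.nodes \ (M ∪ C) ∧ m ∉ C ∪ H.anSet C ∧ (H.anc m i ∨ H.anc m j)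

theorem AgCl.exists_ancPass (hH : IsSummary H) {a b : Bool} {i j : V} (h : AgCl H M C a b i j) :
    Cl (RgCl H M C) (AncPass H M C) a b i j := by
  have tail {a b : Bool} {i j : V} (h : RgCl H M C a b i j) :=
    AgCl.tail hH (M := M) (C := C) (h.mono (fun _ _ _ _ h => h) fun _ _ _ _ _ h => h.agPass)
  have hF : Leaves (fun a b i j => RgCl H M C a.1 b.1 i j ∧ a.2 = a.1 ∧ b.2 = b.1) H.anc
      {i | H.LineEndpoint i} M (C ∪ H.anSet C) (C ∪ H.anSet C) :=
    { symm := fun a b i j h => ⟨h.1.symm hH.edge_symm fun _ _ _ _ _ h => h.symm, h.2.2, h.2.1⟩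
      le := fun a b i j h ha => h.2.1 ▸ ha
      head := fun a b i j h => (h.1.headOf hH.compat).1
      tail := fun a b i j h ha => by
        have := (tail h.1).1 (h.2.1 ▸ ha)
        simpa only [MixedGraph.zone, Set.mem_ofPred_eq, or_assoc] using this
      merge := fun a b c d i m j h₁ h₂ h => by
        refine ⟨a, d, rfl, rfl, .comp h₁.1 h₂.1 ?_, h₁.2.1, h₂.2.2⟩
        rcases h with h | ⟨hb, hc, h⟩
        · exact h
        · rw [h₁.2.2, h₂.2.1, hb, hc] at h
          simp at h }
  obtain ⟨n, a', b', rfl, rfl, h'⟩ := hF.of_closure (N := H.nodes \ (M ∪ C)) (M₁ := ∅)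
    (E := H.edge) (a := a) (b := b) (i := i) (j := j)
    hH.anterior_line (fun _ _ => H.anSet_closed) subset_rfl hH.compat (Set.empty_subset _)
    (fun a b i j h => ⟨(a, a), (b, b), rfl, rfl, .base h, rfl, rfl⟩)
    (fun a b i j h => by
      have := (hH.edge_nodes _ _ _ _ h).2
      simp only [Set.mem_sdiff, Set.mem_union]
      tauto)
    (fun i hi _ hi' => absurd hi hi')
    (fun m t _ hm hmt => by
      obtain ⟨p, hp, hmp, hpt⟩ := exists_generated_arrow (M := M) hH hmt hm
      exact ⟨p, (false, false), (true, true), rfl, rfl,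
        ⟨hp.mono (fun _ _ _ _ h => h) fun _ _ _ _ _ h => h.2, rfl, rfl⟩, hmp,
        hpt.imp_right fun h => ⟨h.1, h.2.1⟩⟩)
    (by rw [Set.union_empty]; exact h)
  replace h' := h'.toCl
  clear h
  induction h' with
  | base h => exact .base h.1
  | comp _ _ h ih₁ ih₂ =>
    refine .comp ih₁ ih₂ ?_
    unfold StuckPass AgPass Mergeable RgPass at h
    unfold AncPass
    simp only [Set.mem_empty_iff_false] at h
    tauto

theorem AgCl.exists_alphaSG (hH : IsSummary H) {a b : Bool} {i j : V} (h : AgCl H M C a b i j)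
    (hi : i ∈ H.nodes \ (M ∪ C)) (hj : j ∈ H.nodes \ (M ∪ C)) (hij : i ≠ j) :
    ∃ a₀ b₀, Cl (alphaSG H M C).edge (AgStep H.anc) a₀ b₀ i j := by
  have flat {a b : Bool} {i j : V} (h : Cl (RgCl H M C) (AncPass H M C) a b i j) :
      AgCl H M C a b i j :=
    h.flatten (fun _ _ _ _ _ h => h.agPass) fun _ _ _ _ _ h => .inl ⟨h.1, h.2.1, .inr h.2.2.2.2⟩
  have loop {a b : Bool} {i : V} (h : AgCl H M C a b i i) (ha : a = false) :
      i ∈ {i | H.LineEndpoint i} ∨ i ∈ C ∪ H.anSet C :=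
    ((AgCl.tail hH h).1 ha).resolve_right (hH.acyclic i)
  obtain ⟨a', b', h', -⟩ := (AgCl.exists_ancPass hH h).loopless
    (E' := Cl H.edge (RgStep M (C ∪ H.anSet C))) (Z := {i | H.LineEndpoint i})
    (M := M) (S := C ∪ H.anSet C)
    (fun _ _ _ _ _ h => ⟨h.2.1, h.1, h.2.2.1, h.2.2.2.1, h.2.2.2.2.symm⟩)
    (fun _ _ _ _ _ h hc => by simp [h.2.1] at hc)
    (fun _ _ _ _ h => (AgCl.head hH (flat h)).1)
    (fun _ _ _ h => loop (flat h))
    (fun _ _ _ _ h => h.symm hH.edge_symm fun _ _ _ _ _ h => h.symm)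
    (fun a b i j h hij => h.loopless (fun _ _ _ _ _ h => h.symm)
      (fun _ _ _ _ _ h hc => by
        rcases h with ⟨-, h, -⟩ | ⟨-, h⟩
        · simp [h] at hc
        · exact h)
      (fun _ _ _ _ h => (AgCl.head hH (flat (.base h))).1)
      (fun _ _ _ h => loop (flat (.base h)))
      hH.edge_symm
      (fun a b _ _ h _ => ⟨a, b, h, .inl rfl, .inl rfl⟩)
      (fun _ _ _ _ _ _ _ h hb hc => by unfold RgPass Dom at *; grind)
      hij)
    (fun _ _ _ _ m i j h hb hc => by
      have : m ∉ M := fun hm => h.2.2.1.2 (.inl hm)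
      unfold AncPass Dom at *
      grind) hij
  have key : ∀ {a b i j}, Cl (Cl H.edge (RgStep M (C ∪ H.anSet C)))
      (fun b c m i j => i ≠ j ∧ AncPass H M C b c m i j) a b i j → i ∈ H.nodes \ (M ∪ C) →
      j ∈ H.nodes \ (M ∪ C) → ∃ a₀ b₀, Cl (alphaSG H M C).edge (AgStep H.anc) a₀ b₀ i j ∧
        (a = true → i ∉ C ∪ H.anSet C → a₀ = true) ∧
        (b = true → j ∉ C ∪ H.anSet C → b₀ = true) := by
    intro a b i j h
    induction h with
    | @base a b i j h =>
      intro hi hj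
      obtain ⟨a₀, ha⟩ := exists_bool_iff (a = true ∧ i ∉ C ∪ H.anSet C)
      obtain ⟨b₀, hb⟩ := exists_bool_iff (b = true ∧ j ∉ C ∪ H.anSet C)
      exact ⟨a₀, b₀, .base ((alphaSG_edge hH).2 ⟨hi, hj, a, b, h, ha, hb⟩),
        fun h h' => ha.2 ⟨h, h'⟩, fun h h' => hb.2 ⟨h, h'⟩⟩
    | comp _ _ h ih₁ ih₂ =>
      intro hi hj
      obtain ⟨hij, hb, hc, hmN, hmS, hm⟩ := h
      obtain ⟨a₀, b₀, h₁, ha, hb'⟩ := ih₁ hi hmN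
      obtain ⟨c₀, d₀, h₂, hc', hd⟩ := ih₂ hmN hj
      exact ⟨a₀, d₀, .comp h₁ h₂ ⟨hij, hb' hb hmS, hc' hc hmS, hm⟩, ha, hd⟩
  obtain ⟨a₀, b₀, h, -⟩ := key h' hi hj
  exact ⟨a₀, b₀, h⟩

/-- Edges of the graph generated by the AG-generating map. -/
theorem alphaAG_edge (hH : IsSummary H) {a b : Bool} {i j : V} :
    (alphaAG H M C).edge a b i j ↔ i ∈ H.nodes \ (M ∪ C) ∧ j ∈ H.nodes \ (M ∪ C) ∧ i ≠ j ∧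
      (∃ a₀ b₀, AgCl H M C a₀ b₀ i j) ∧ AgLabel H.anc (H.zone C) a i j ∧
      AgLabel H.anc (H.zone C) b j i := by
  rw [alphaAG, alphaSGAG_edge (hH.anterior C) (alphaSG_compat hH) (fun _ _ => alphaSG_anc hH)]
  · constructor
    · rintro ⟨⟨a₀, b₀, h⟩, h'⟩
      obtain ⟨hi, hj, hij, a₁, b₁, h, -⟩ := AgCl.of_alphaSG hH h
      exact ⟨hi, hj, hij, ⟨a₁, b₁, h⟩, h'⟩
    · rintro ⟨hi, hj, hij, ⟨a₀, b₀, h⟩, h'⟩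
      exact ⟨AgCl.exists_alphaSG hH h hi hj hij, h'⟩
  · intro a b i j h hj c d k l h' hjl
    exact alphaSG_anc_of_anc hH (fun h => hj (.inr h)) ((alphaSG_edge hH).1 h).2.1
      ((alphaSG_edge hH).1 h').2.1 hjl

theorem alphaAG_compat (hH : IsSummary H) :
    Compat (alphaAG H M C).edge H.anc (H.zone C) where
  symm a b i j h := by
    obtain ⟨hi, hj, hij, ⟨a₀, b₀, h⟩, ha, hb⟩ := (alphaAG_edge hH).1 h
    exact (alphaAG_edge hH).2 ⟨hj, hi, hij.symm, ⟨b₀, a₀, AgCl.symm hH h⟩, hb, ha⟩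
  tail b i j h := by
    have := ((alphaAG_edge hH).1 h).2.2.2.2.1
    simp only [AgLabel] at this
    tauto
  head b i j h := (((alphaAG_edge hH).1 h).2.2.2.2.1.1 rfl).1

theorem alphaAG_nodes (hH : IsSummary H) {a b : Bool} {i j : V}
    (h : (alphaAG H M C).edge a b i j) : i ∈ H.nodes \ (M ∪ C) ∧ j ∈ H.nodes \ (M ∪ C) :=
  ⟨((alphaAG_edge hH).1 h).1, ((alphaAG_edge hH).1 h).2.1⟩

theorem alphaAG_anc (hH : IsSummary H) {i j : V} (hi : i ∉ H.zone C)
    (h : (alphaAG H M C).anc i j) : H.anc i j := by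
  have hK := alphaAG_compat (M := M) (C := C) hH
  induction h using Relation.TransGen.head_induction_on with
  | single h => exact (hK.tail true _ _ h).resolve_left hi
  | @head i k h _ ih =>
    exact ((hK.tail true _ _ h).resolve_left hi).trans
      (ih (hK.head false _ _ (hK.symm false true _ _ h)))

theorem alphaAG_anc_of_anc (hH : IsSummary H) {i j : V} (hi : i ∉ C ∪ H.anSet C)
    (hiN : i ∈ H.nodes \ (M ∪ C)) (hjN : j ∈ H.nodes \ (M ∪ C)) (h : H.anc i j) :
    (alphaAG H M C).anc i j :=
  Relation.TransGen.mono (fun _ _ h => AG3Arrow.base (AG2Arrow.base h)) _ _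
    (alphaSG_anc_of_anc hH hi hiN hjN h)

theorem alphaAG_lineEndpoint (hH : IsSummary H) {i : V} (h : (alphaAG H M C).LineEndpoint i) :
    i ∈ H.zone C := by
  obtain ⟨j, h⟩ := h
  have hK := alphaAG_compat (M := M) (C := C) hH
  have hP := hH.anterior C
  rcases hK.tail false i j h with hi | hi
  · exact hi
  · rcases hK.tail false j i (hK.symm false false _ _ h) with hj | hj
    · exact hP.closed _ _ hi hj
    · exact absurd (hi.trans hj) (hH.acyclic i)

theorem alphaAG_isSummary (hH : IsSummary H) : IsSummary (alphaAG H M C) where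
  wf := by
    have hK := alphaAG_compat (M := M) (C := C) hH
    refine ⟨fun i j h => hK.symm true true _ _ h, fun i j h => hK.symm false false _ _ h, ?_⟩
    rintro i j (h | h | h)
    · exact alphaAG_nodes (a := false) (b := true) hH h
    · exact alphaAG_nodes (a := true) (b := true) hH h
    · exact alphaAG_nodes (a := false) (b := false) hH h
  loopless i := by
    refine ⟨fun h => ?_, fun h => ?_, fun h => ?_⟩
    · exact ((alphaAG_edge (a := false) (b := true) hH).1 h).2.2.1 rfl
    · exact ((alphaAG_edge (a := true) (b := true) hH).1 h).2.2.1 rfl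
    · exact ((alphaAG_edge (a := false) (b := false) hH).1 h).2.2.1 rfl
  line_head i hi k := by
    have hK := alphaAG_compat (M := M) (C := C) hH
    have hi := alphaAG_lineEndpoint hH hi
    exact ⟨fun h => hK.head false i k h hi, fun h => hK.head true i k (hK.symm true true _ _ h) hi⟩
  acyclic i h := by
    have hK := alphaAG_compat (M := M) (C := C) hH
    obtain ⟨k, -, hk⟩ := Relation.TransGen.tail'_iff.1 h
    exact hH.acyclic i (alphaAG_anc hH (hK.head false i k hk) h)

end Eliminate

section Split

variable {H : MixedGraph V} {M C M₁ C₁ : Set V}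

theorem MixedGraph.mem_anSet_union (H : MixedGraph V) {C C₁ : Set V} {i : V} :
    i ∈ (C ∪ C₁) ∪ H.anSet (C ∪ C₁) ↔ i ∈ C ∪ H.anSet C ∨ i ∈ C₁ ∪ H.anSet C₁ := by
  simp only [MixedGraph.anSet, Set.mem_union, Set.mem_ofPred_eq, or_and_right, exists_or]
  exact or_or_or_comm

theorem MixedGraph.zone_subset (H : MixedGraph V) (C C₁ : Set V) :
    H.zone C ⊆ H.zone (C ∪ C₁) := fun _ h =>
  h.imp_right fun h => H.mem_anSet_union.2 (.inl h)

theorem anSet_of_alphaAG (hH : IsSummary H) {i : V} (hi : i ∉ H.zone C)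
    (h : i ∈ C₁ ∪ (alphaAG H M C).anSet C₁) : i ∈ (C ∪ C₁) ∪ H.anSet (C ∪ C₁) := by
  rw [H.mem_anSet_union]
  rcases h with h | ⟨c, hc, h⟩
  · exact .inr (.inl h)
  · exact .inr (.inr ⟨c, hc, alphaAG_anc hH hi h⟩)

theorem anSet_alphaAG_of (hH : IsSummary H) (hC₁ : C₁ ⊆ H.nodes \ (M ∪ C)) {i : V}
    (hi : i ∉ H.zone C) (hiN : i ∈ H.nodes \ (M ∪ C))
    (h : i ∈ (C ∪ C₁) ∪ H.anSet (C ∪ C₁)) : i ∈ C₁ ∪ (alphaAG H M C).anSet C₁ := by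
  have hi : i ∉ C ∪ H.anSet C := fun h => hi (.inr h)
  rcases (H.mem_anSet_union.1 h).resolve_left hi with h | ⟨c, hc, h⟩
  · exact .inl h
  · exact .inr ⟨c, hc, alphaAG_anc_of_anc hH hi hiN (hC₁ hc) h⟩

theorem AgCl.mono (M₁ C₁ : Set V) {a b : Bool} {i j : V} (h : AgCl H M C a b i j) :
    AgCl H (M ∪ M₁) (C ∪ C₁) a b i j := by
  refine Cl.mono (fun _ _ _ _ h => h) (fun b c m i j h => ?_) h
  have : m ∈ C ∪ H.anSet C → m ∈ (C ∪ C₁) ∪ H.anSet (C ∪ C₁) := fun h =>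
    H.mem_anSet_union.2 (.inl h)
  have : m ∈ M → m ∈ M ∪ M₁ := .inl
  unfold AgPass at *
  tauto

theorem AgCl.of_alphaAG (hH : IsSummary H) {a b : Bool} {i j : V}
    (h : AgCl (alphaAG H M C) M₁ C₁ a b i j) :
    ∃ a₀ b₀, AgCl H (M ∪ M₁) (C ∪ C₁) a₀ b₀ i j ∧ (a = true → a₀ = true) ∧
      (b = true → b₀ = true) := by
  have hR := alphaAG_isSummary (M := M) (C := C) hH
  have hK := alphaAG_compat (M := M) (C := C) hH
  induction h with
  | @base a b i j h =>
    obtain ⟨-, -, -, ⟨a₀, b₀, h⟩, ha, hb⟩ := (alphaAG_edge hH).1 h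
    have t := AgCl.tail hH h
    refine ⟨a₀, b₀, AgCl.mono M₁ C₁ h, fun h => ?_, fun h => ?_⟩
    · have := ha.1 h
      by_contra ha₀
      have := t.1 (by simpa using ha₀)
      tauto
    · have := hb.1 h
      by_contra hb₀
      have := t.2 (by simpa using hb₀)
      tauto
  | @comp a b c d i m j h₁ h₂ h ih₁ ih₂ =>
    obtain ⟨a₀, b₀, h₁', ha, hb⟩ := ih₁
    obtain ⟨c₀, d₀, h₂', hc, hd⟩ := ih₂
    refine ⟨a₀, d₀, .comp h₁' h₂' ?_, ha, hd⟩
    have anc (k : V) (hm : m ∉ H.zone C) : (alphaAG H M C).anc m k → H.anc m k :=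
      alphaAG_anc hH hm
    have hS (hm : m ∉ H.zone C) := anSet_of_alphaAG (M := M) (C₁ := C₁) hH hm
    have hS' : m ∈ C ∪ H.anSet C → m ∈ (C ∪ C₁) ∪ H.anSet (C ∪ C₁) := fun h =>
      H.mem_anSet_union.2 (.inl h)
    have hL := alphaAG_lineEndpoint (M := M) (C := C) (i := m) hH
    have z : m ∈ H.zone C ↔ H.LineEndpoint m ∨ m ∈ C ∪ H.anSet C := Iff.rfl
    have zR : m ∈ (alphaAG H M C).zone C₁ ↔ (alphaAG H M C).LineEndpoint m ∨
      m ∈ C₁ ∪ (alphaAG H M C).anSet C₁ := Iff.rfl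
    have t₁ := (AgCl.tail hR h₁).2
    have t₂ := (AgCl.tail hR h₂).1
    have e₁ := (h₁.headOf hK).2
    have e₂ := (h₂.headOf hK).1
    have e₁' := (AgCl.head hH h₁').2
    have hi := anc i
    have hj := anc j
    have hM : m ∈ M₁ → m ∈ M ∪ M₁ := .inr
    clear anc hK hR h₁ h₂ h₁' h₂' ha hd
    unfold AgPass at *
    grind

/-- The canonically labelled adjacencies among the remaining nodes, loops allowed. -/
abbrev AgLoop (H : MixedGraph V) (M C : Set V) (a b : Bool) (i j : V) : Prop :=
  i ∈ H.nodes \ (M ∪ C) ∧ j ∈ H.nodes \ (M ∪ C) ∧ (∃ a₀ b₀, AgCl H M C a₀ b₀ i j) ∧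
    AgLabel H.anc (H.zone C) a i j ∧ AgLabel H.anc (H.zone C) b j i

theorem AgLoop.compat (hH : IsSummary H) : Compat (AgLoop H M C) H.anc (H.zone C) where
  symm a b i j h := by
    obtain ⟨hi, hj, ⟨a₀, b₀, h⟩, ha, hb⟩ := h
    exact ⟨hj, hi, ⟨b₀, a₀, AgCl.symm hH h⟩, hb, ha⟩
  tail b i j h := by
    have := h.2.2.2.1
    simp only [AgLabel] at this
    tauto
  head b i j h := (h.2.2.2.1.1 rfl).1

/-- Labels of the adjacencies obtained by eliminating `M` and `C`, before and after removing
arrowheads. -/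
abbrev AgLeaf (H : MixedGraph V) (M C : Set V) (a b : Bool × Bool) (i j : V) : Prop :=
  AgCl H M C a.1 b.1 i j ∧ (a.2 = true ↔ a.1 = true ∧ i ∉ C ∪ H.anSet C ∧ ¬ H.anc i j) ∧
    (b.2 = true ↔ b.1 = true ∧ j ∉ C ∪ H.anSet C ∧ ¬ H.anc j i)

theorem AgCl.exists_leaf {a b : Bool} {i j : V} (h : AgCl H M C a b i j) :
    ∃ a' b' : Bool × Bool, a'.1 = a ∧ b'.1 = b ∧ AgLeaf H M C a' b' i j := by
  obtain ⟨a', ha⟩ := exists_bool_iff (a = true ∧ i ∉ C ∪ H.anSet C ∧ ¬ H.anc i j)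
  obtain ⟨b', hb⟩ := exists_bool_iff (b = true ∧ j ∉ C ∪ H.anSet C ∧ ¬ H.anc j i)
  exact ⟨(a, a'), (b, b'), rfl, rfl, h, ha, hb⟩

theorem AgLeaf.leaves (hH : IsSummary H) (C₁ : Set V) :
    Leaves (AgLeaf H M C) H.anc {i | H.LineEndpoint i} M (C ∪ H.anSet C)
      ((C ∪ C₁) ∪ H.anSet (C ∪ C₁)) where
  symm a b i j h := ⟨AgCl.symm hH h.1, h.2.2, h.2.1⟩
  le a b i j h ha := (h.2.1.1 ha).1
  head a b i j h := (AgCl.head hH h.1).1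
  tail a b i j h ha := by
    have t := (AgCl.tail hH h.1).1
    have z : i ∈ H.zone C ↔ H.LineEndpoint i ∨ i ∈ C ∪ H.anSet C := Iff.rfl
    have hS : i ∈ C ∪ H.anSet C → i ∈ (C ∪ C₁) ∪ H.anSet (C ∪ C₁) := fun h =>
      H.mem_anSet_union.2 (.inl h)
    have := h.2.1
    rw [Set.mem_ofPred_eq]
    grind
  merge a b c d i m j h₁ h₂ h := by
    refine AgCl.exists_leaf (.comp h₁.1 h₂.1 ?_)
    have := h₁.2.2
    have := h₂.2.1
    unfold Mergeable RgPass at h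
    unfold AgPass
    grind

theorem AgCl.exists_loop (hH : IsSummary H) (hM₁ : M₁ ⊆ H.nodes \ (M ∪ C))
    (hC₁ : C₁ ⊆ H.nodes \ (M ∪ C)) {a b : Bool} {i j : V}
    (h : AgCl H (M ∪ M₁) (C ∪ C₁) a b i j) (hi : i ∈ H.nodes \ (M ∪ C))
    (hj : j ∈ H.nodes \ (M ∪ C)) :
    ∃ a' b', Cl (AgLoop H M C) (AgPass H.anc M₁ ((C ∪ C₁) ∪ H.anSet (C ∪ C₁))) a' b' i j := by
  have hF := AgLeaf.leaves (M := M) (C := C) hH C₁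
  obtain ⟨n, a', b', rfl, rfl, h'⟩ := hF.of_closure (N := H.nodes \ (M ∪ C)) (M₁ := M₁)
    hH.anterior_line (fun _ _ => H.anSet_closed)
    (fun _ h => H.mem_anSet_union.2 (.inl h)) hH.compat hM₁
    (fun a b i j h => AgCl.exists_leaf (.base h))
    (fun a b i j h => by
      have := (hH.edge_nodes _ _ _ _ h).2
      simp only [Set.mem_sdiff, Set.mem_union]
      tauto)
    (fun i hi hiM hiS => by
      rcases (H.mem_anSet_union.1 hi).resolve_left hiS with h | ⟨c, hc, h⟩
      · exact absurd (.inl hiM) (hC₁ h).2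
      · exact ⟨c, H.mem_anSet_union.2 (.inr (.inl hc)), hC₁ hc, h⟩)
    (fun m t _ hm hmt => by
      obtain ⟨p, hp, hmp, hpt⟩ := exists_generated_arrow (M := M) hH hmt hm
      obtain ⟨a', b', ha, hb, h⟩ := AgCl.exists_leaf hp.rgStep_agCl
      exact ⟨p, a', b', ha, hb, h, hmp, hpt.imp_right fun h => ⟨h.1, h.2.1⟩⟩) h
  refine ⟨a'.2, b'.2, ?_⟩
  replace h' := h'.toCl
  clear h
  induction h' with
  | @base a b i j h =>
    refine .base ⟨hi, hj, ⟨_, _, h.1⟩, ?_⟩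
    have t := AgCl.tail hH h.1
    have e := AgCl.head hH h.1
    have zi : i ∈ H.zone C ↔ H.LineEndpoint i ∨ i ∈ C ∪ H.anSet C := Iff.rfl
    have zj : j ∈ H.zone C ↔ H.LineEndpoint j ∨ j ∈ C ∪ H.anSet C := Iff.rfl
    have := h.2
    unfold AgLabel
    grind
  | @comp a b c d i m j h₁ h₂ h ih₁ ih₂ =>
    refine .comp (ih₁ hi h.1) (ih₂ h.1 hj) ?_
    have l₁ := (hF.closure hH.anterior_line (fun _ _ => H.anSet_closed) h₁).2.1
    have l₂ := (hF.closure hH.anterior_line (fun _ _ => H.anSet_closed) h₂).1.1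
    unfold StuckPass AgPass Mergeable at h
    unfold AgPass
    grind

theorem AgCl.exists_alphaAG (hH : IsSummary H) (hM₁ : M₁ ⊆ H.nodes \ (M ∪ C))
    (hC₁ : C₁ ⊆ H.nodes \ (M ∪ C)) {a b : Bool} {i j : V}
    (h : AgCl H (M ∪ M₁) (C ∪ C₁) a b i j) (hi : i ∈ H.nodes \ (M ∪ C))
    (hj : j ∈ H.nodes \ (M ∪ C)) (hij : i ≠ j) :
    ∃ a' b', AgCl (alphaAG H M C) M₁ C₁ a' b' i j := by
  obtain ⟨a', b', h₀⟩ := AgCl.exists_loop hH hM₁ hC₁ h hi hj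
  clear h
  have hK := alphaAG_compat (M := M) (C := C) hH
  have hL := AgLoop.compat (M := M) (C := C) hH
  obtain ⟨a', b', h, -⟩ := h₀.loopless (E' := (alphaAG H M C).edge) (Z := H.zone C)
    (M := M₁) (S := (C ∪ C₁) ∪ H.anSet (C ∪ C₁))
    (fun _ _ _ _ _ h => h.symm)
    (fun _ _ _ _ _ h hc => by
      rcases h with ⟨-, h, -⟩ | ⟨-, h⟩
      · simp [h] at hc
      · exact h)
    (fun _ _ _ _ h => (h.headOf hL).1)
    (fun _ _ i h ha => by
      have := (h.tailOf (hH.anterior C) hL (fun _ _ => H.anSet_closed)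
        (fun _ _ _ _ _ h => h)).1 ha
      have := hH.acyclic i
      tauto)
    hL.symm
    (fun a b _ _ h hij => ⟨a, b, (alphaAG_edge hH).2 ⟨h.1, h.2.1, hij, h.2.2⟩,
      .inl rfl, .inl rfl⟩)
    (fun _ _ _ _ _ _ _ h hb hc => by unfold AgPass Dom at *; grind)
    hij
  refine ⟨a', b', ?_⟩
  have nodes : ∀ {a b i j}, Cl (alphaAG H M C).edge (fun b c m i j => i ≠ j ∧
      AgPass H.anc M₁ ((C ∪ C₁) ∪ H.anSet (C ∪ C₁)) b c m i j) a b i j →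
      i ∈ H.nodes \ (M ∪ C) ∧ j ∈ H.nodes \ (M ∪ C) := by
    intro a b i j h
    induction h with
    | base h => exact alphaAG_nodes hH h
    | comp _ _ _ ih₁ ih₂ => exact ⟨ih₁.1, ih₂.2⟩
  clear hi hj hij h₀
  induction h with
  | base h => exact .base h
  | comp h₁ h₂ h ih₁ ih₂ =>
    refine .comp ih₁ ih₂ ?_
    obtain ⟨-, ⟨hb, hc, h⟩ | h⟩ := h
    · have hm := (h₁.headOf hK).2 hb
      have hm' : _ ∉ C ∪ H.anSet C := fun h => hm (.inr h)
      obtain ⟨hi, hmN⟩ := nodes h₁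
      exact .inl ⟨hb, hc, h.imp (anSet_alphaAG_of hH hC₁ hm hmN) (.imp
        (alphaAG_anc_of_anc hH hm' hmN hi) (alphaAG_anc_of_anc hH hm' hmN (nodes h₂).2))⟩
    · exact .inr h

theorem agLabel_alphaAG (hH : IsSummary H) (hC₁ : C₁ ⊆ H.nodes \ (M ∪ C)) {a b c : Bool}
    {i j : V} (h : AgCl (alphaAG H M C) M₁ C₁ b c i j) (hi : i ∈ H.nodes \ (M ∪ C))
    (hj : j ∈ H.nodes \ (M ∪ C)) :
    AgLabel (alphaAG H M C).anc ((alphaAG H M C).zone C₁) a i j ↔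
      AgLabel H.anc (H.zone (C ∪ C₁)) a i j := by
  have hR := alphaAG_isSummary (M := M) (C := C) hH
  have hK := alphaAG_compat (M := M) (C := C) hH
  have : i ∈ (alphaAG H M C).zone C₁ ∨ (alphaAG H M C).anc i j ↔
      i ∈ H.zone (C ∪ C₁) ∨ H.anc i j := by
    by_cases hz : i ∈ H.zone C
    · have hb : b = false := by
        by_contra hb
        exact (h.headOf hK).1 (by simpa using hb) hz
      exact iff_of_true ((AgCl.tail hR h).1 hb) (.inl (H.zone_subset C C₁ hz))
    · have hS : i ∉ C ∪ H.anSet C := fun h => hz (.inr h)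
      refine or_congr ⟨?_, ?_⟩ ⟨alphaAG_anc hH hz, alphaAG_anc_of_anc hH hS hi hj⟩
      · rintro (h | h)
        · exact absurd (alphaAG_lineEndpoint hH h) hz
        · exact .inr (anSet_of_alphaAG hH hz h)
      · rintro (h | h)
        · exact absurd (.inl h) hz
        · exact .inr (anSet_alphaAG_of hH hC₁ hz hi h)
  unfold AgLabel
  rw [← not_or, ← not_or, this]

theorem alphaAG_alphaAG (hH : IsSummary H) (hM₁ : M₁ ⊆ H.nodes \ (M ∪ C))
    (hC₁ : C₁ ⊆ H.nodes \ (M ∪ C)) :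
    alphaAG (alphaAG H M C) M₁ C₁ = alphaAG H (M ∪ M₁) (C ∪ C₁) := by
  have hR := alphaAG_isSummary (M := M) (C := C) hH
  have hN : (alphaAG H M C).nodes \ (M₁ ∪ C₁) = H.nodes \ ((M ∪ M₁) ∪ (C ∪ C₁)) := by
    rw [Set.union_union_union_comm, ← Set.sdiff_sdiff (s := H.nodes) (t := M ∪ C)]
    rfl
  refine MixedGraph.ext_edge hN fun a b i j => ?_
  rw [alphaAG_edge hR, alphaAG_edge hH, hN]
  refine and_congr_right fun hi => and_congr_right fun hj => and_congr_right fun hij => ?_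
  rw [← hN] at hi hj
  constructor
  · rintro ⟨⟨a₀, b₀, h⟩, ha, hb⟩
    obtain ⟨a₁, b₁, h', -⟩ := AgCl.of_alphaAG hH h
    exact ⟨⟨a₁, b₁, h'⟩, (agLabel_alphaAG hH hC₁ h hi.1 hj.1).1 ha,
      (agLabel_alphaAG hH hC₁ (AgCl.symm hR h) hj.1 hi.1).1 hb⟩
  · rintro ⟨⟨a₀, b₀, h⟩, ha, hb⟩
    obtain ⟨a₁, b₁, h⟩ := AgCl.exists_alphaAG hH hM₁ hC₁ h hi.1 hj.1 hij
    exact ⟨⟨a₁, b₁, h⟩, (agLabel_alphaAG hH hC₁ h hi.1 hj.1).2 ha,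
      (agLabel_alphaAG hH hC₁ (AgCl.symm hR h) hj.1 hi.1).2 hb⟩

end Split

/-- (Theorem 5) `α_AG` is well-defined with respect to
splitting the marginalisation and conditioning sets: for an ancestral graph
`H` and pairwise disjoint subsets `C`, `C₁`, `M`, `M₁` of its node set,
`α_AG(α_AG(H;M,C);M₁,C₁) = α_AG(H;M∪M₁,C∪C₁)`. -/
theorem stmt_18 {V : Type} (H : MixedGraph V) (M C M₁ C₁ : Set V)
    (hH : H.IsAG)
    (hM : M ⊆ H.nodes) (hC : C ⊆ H.nodes)
    (hM₁ : M₁ ⊆ H.nodes) (hC₁ : C₁ ⊆ H.nodes)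
    (hMC : Disjoint M C) (hMM₁ : Disjoint M M₁) (hMC₁ : Disjoint M C₁)
    (hCM₁ : Disjoint C M₁) (hCC₁ : Disjoint C C₁) (hM₁C₁ : Disjoint M₁ C₁) :
    alphaAG (alphaAG H M C) M₁ C₁ = alphaAG H (M ∪ M₁) (C ∪ C₁) := by
  refine alphaAG_alphaAG hH.isSummary (fun i hi => ⟨hM₁ hi, ?_⟩) fun i hi => ⟨hC₁ hi, ?_⟩
  · exact fun h => h.elim (fun h => hMM₁.le_bot ⟨h, hi⟩) fun h => hCM₁.le_bot ⟨h, hi⟩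
  · exact fun h => h.elim (fun h => hMC₁.le_bot ⟨h, hi⟩) fun h => hCC₁.le_bot ⟨h, hi⟩

end StableMixedGraphs
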